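/- Let n ≥ 1 and let X be a separable metrizable space. If X is an 𝔈-factor, i.e., there exists a topological space Z such that X × Z is homeomorphic to Erdős space 𝔈, then F_n(X) with the Vietoris topology is an 𝔈-factor. -/

import Mathlib

open Set Topology

noncomputable section

/-- The Vietoris topology on the powerset of `X` induced by a topology `τ`,
generated by the sets `{F | F ⊆ U}` and `{F | F ∩ U ≠ ∅}` for `U` a nonempty `τ`-open set. -/
def VietorisTop {X : Type*} (τ : TopologicalSpace X) : TopologicalSpace (Set X) :=
  TopologicalSpace.generateFrom
    ({S : Set (Set X) | ∃ U : Set X, IsOpen[τ] U ∧ U.Nonempty ∧ S = {F : Set X | F ⊆ U}} ∪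
     {S : Set (Set X) | ∃ U : Set X, IsOpen[τ] U ∧ U.Nonempty ∧ S = {F : Set X | (F ∩ U).Nonempty}})

/-- The hyperspace `K(X)` of nonempty compact subsets of `X`. -/
def HypK (X : Type*) [TopologicalSpace X] : Type _ := {F : Set X // F.Nonempty ∧ IsCompact F}

/-- `K(X)` carries the Vietoris topology. -/
instance (X : Type*) [τ : TopologicalSpace X] : TopologicalSpace (HypK X) :=
  (VietorisTop τ).induced Subtype.val

/-- The `n`-th symmetric product `F_n(X)`: nonempty subsets of `X` with at most `n` points. -/
def HypFn (n : ℕ) (X : Type*) [TopologicalSpace X] : Type _ :=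
  {F : Set X // F.Nonempty ∧ F.Finite ∧ F.ncard ≤ n}

/-- `F_n(X)` carries the Vietoris topology. -/
instance (n : ℕ) (X : Type*) [τ : TopologicalSpace X] : TopologicalSpace (HypFn n X) :=
  (VietorisTop τ).induced Subtype.val

/-- The hyperspace `F(X)` of nonempty finite subsets of `X`. -/
def HypFin (X : Type*) [TopologicalSpace X] : Type _ := {F : Set X // F.Nonempty ∧ F.Finite}

/-- `F(X)` carries the Vietoris topology. -/
instance (X : Type*) [τ : TopologicalSpace X] : TopologicalSpace (HypFin X) :=
  (VietorisTop τ).induced Subtype.val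

/-- A space is almost zero-dimensional if every point has a neighborhood basis consisting of
sets each of which is an intersection of clopen sets. -/
def IsAZD (X : Type*) [TopologicalSpace X] : Prop :=
  ∀ x : X, ∀ U ∈ nhds x, ∃ V ∈ nhds x, V ⊆ U ∧
    ∃ C : Set (Set X), (∀ c ∈ C, IsClopen c) ∧ V = ⋂₀ C

/-- `X` is `𝒜`-cohesive: every point has a neighborhood containing no nonempty proper
subset of an element `A ∈ 𝒜` that is clopen in the subspace topology of `A`. -/
def CohesiveWrt (X : Type*) [TopologicalSpace X] (𝒜 : Set (Set X)) : Prop :=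
  ∀ x : X, ∃ U ∈ nhds x, ∀ A ∈ 𝒜, ∀ C : Set X,
    C ⊆ U → C ⊆ A → C.Nonempty → C ≠ A → ¬ IsClopen {y : A | (y : X) ∈ C}

/-- A space is cohesive if it is `{X}`-cohesive. -/
def Cohesive (X : Type*) [TopologicalSpace X] : Prop := CohesiveWrt X {Set.univ}

/-- Erdős space: the rational points of the Hilbert space `ℓ²`. -/
def ErdosSpace : Type :=
  {x : lp (fun _ : ℕ => ℝ) 2 // ∀ n : ℕ, ∃ q : ℚ, x.val n = (q : ℝ)}

instance : TopologicalSpace ErdosSpace := by unfold ErdosSpace; infer_instance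

/-- Complete Erdős space: points of `ℓ²` all of whose coordinates lie in `{0} ∪ {1/m : m ≥ 1}`. -/
def CompleteErdosSpace : Type :=
  {x : lp (fun _ : ℕ => ℝ) 2 // ∀ n : ℕ, x.val n = 0 ∨ ∃ m : ℕ, 0 < m ∧ x.val n = 1 / (m : ℝ)}

instance : TopologicalSpace CompleteErdosSpace := by unfold CompleteErdosSpace; infer_instance

/-- A sequence of maps `c n : A → D`, each refining the previous one, whose fibres form a
neighbourhood basis at every point. -/
structure IsCode {A D : Type*} [TopologicalSpace A] (c : ℕ → A → D) : Prop where
  refine_succ : ∀ n x y, c (n + 1) x = c (n + 1) y → c n x = c n y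
  basis : ∀ a, (𝓝 a).HasBasis (fun _ : ℕ => True) (fun n => {x | c n x = c n a})

namespace IsCode

variable {A D : Type*} [TopologicalSpace A] {c : ℕ → A → D}

theorem mono (h : IsCode c) {m n : ℕ} (hmn : m ≤ n) {x y : A} (hxy : c n x = c n y) :
    c m x = c m y := by
  induction hmn with
  | refl => exact hxy
  | step _ ih => exact ih (h.refine_succ _ _ _ hxy)

theorem cone_mem (h : IsCode c) (n : ℕ) (a : A) : {x | c n x = c n a} ∈ 𝓝 a :=
  (h.basis a).mem_of_mem trivial

theorem eventually (h : IsCode c) (n : ℕ) (a : A) : ∀ᶠ x in 𝓝 a, c n x = c n a :=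
  h.cone_mem n a

theorem exists_cone (h : IsCode c) {a : A} {U : Set A} (hU : U ∈ 𝓝 a) (m : ℕ) :
    ∃ n, m ≤ n ∧ ∀ x, c n x = c n a → x ∈ U := by
  obtain ⟨n, -, hn⟩ := (h.basis a).mem_iff.1 hU
  exact ⟨max m n, le_max_left _ _, fun x hx => hn (h.mono (le_max_right _ _) hx)⟩

theorem eq_of_forall [T1Space A] (h : IsCode c) {x y : A} (hxy : ∀ n, c n x = c n y) : x = y := by
  by_contra hne
  obtain ⟨n, -, hn⟩ := h.exists_cone (isOpen_ne.mem_nhds (Ne.symm hne) : {z | z ≠ x} ∈ 𝓝 y) 0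
  exact hn x (hxy n) rfl

/-- A property that holds on small cones holds with a locally constant choice of level. -/
theorem exists_level (h : IsCode c) {P : A → ℕ → Prop}
    (hP : ∀ a, ∃ n, ∀ x, c n x = c n a → P x n) :
    ∃ f : A → ℕ, (∀ a x, c (f a) x = c (f a) a → f x = f a) ∧ ∀ a, P a (f a) := by
  classical
  refine ⟨fun a => Nat.find (hP a), fun a x hx => ?_, fun a => Nat.find_spec (hP a) a rfl⟩
  have key : ∀ m ≤ Nat.find (hP a),
      (∀ y, c m y = c m x → P y m) ↔ (∀ y, c m y = c m a → P y m) := by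
    intro m hm
    rw [h.mono hm hx]
  apply le_antisymm
  · exact Nat.find_min' _ ((key _ le_rfl).2 (Nat.find_spec (hP a)))
  · by_contra hlt
    push Not at hlt
    exact Nat.find_min (hP a) hlt ((key _ hlt.le).1 (Nat.find_spec (hP x)))

theorem prod {B D' : Type*} [TopologicalSpace B] {c' : ℕ → B → D'} (h : IsCode c)
    (h' : IsCode c') : IsCode (fun n (x : A × B) => (c n x.1, c' n x.2)) where
  refine_succ n x y hxy := by
    simp only [Prod.mk.injEq] at hxy ⊢
    exact ⟨h.refine_succ _ _ _ hxy.1, h'.refine_succ _ _ _ hxy.2⟩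
  basis := by
    rintro ⟨a, b⟩
    refine ⟨fun U => ⟨fun hU => ?_, ?_⟩⟩
    · rw [nhds_prod_eq, Filter.mem_prod_iff] at hU
      obtain ⟨V, hV, W, hW, hVW⟩ := hU
      obtain ⟨n, -, hn⟩ := h.exists_cone hV 0
      obtain ⟨m, hnm, hm⟩ := h'.exists_cone hW n
      refine ⟨m, trivial, fun x hx => hVW ⟨hn _ (h.mono hnm ?_), hm _ ?_⟩⟩
      · exact (Prod.ext_iff.1 hx).1
      · exact (Prod.ext_iff.1 hx).2
    · rintro ⟨n, -, hn⟩
      refine Filter.mem_of_superset (prod_mem_nhds (h.cone_mem n a) (h'.cone_mem n b)) ?_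
      rintro x ⟨h1, h2⟩
      exact hn (Prod.ext h1 h2)

theorem comp_isInducing {B : Type*} [TopologicalSpace B] {f : B → A} (hf : IsInducing f)
    (h : IsCode c) : IsCode (fun n x => c n (f x)) where
  refine_succ n x y hxy := h.refine_succ _ _ _ hxy
  basis b := by
    rw [hf.nhds_eq_comap]
    exact (h.basis (f b)).comap f

theorem subtype {s : Set A} (h : IsCode c) : IsCode (fun n (x : s) => c n x) :=
  comp_isInducing IsInducing.subtypeVal h

theorem of_discrete (A : Type*) [TopologicalSpace A] [DiscreteTopology A] :
    IsCode (fun (_ : ℕ) (x : A) => x) where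
  refine_succ _ _ _ h := h
  basis a := by
    rw [nhds_discrete]
    refine ⟨fun U => ⟨fun hU => ⟨0, trivial, ?_⟩, fun ⟨_, _, h⟩ => h rfl⟩⟩
    rintro x rfl
    exact hU

theorem pi (h : IsCode c) :
    IsCode (fun n (u : ℕ → A) (k : ℕ) => if k < n then some (c n (u k)) else none) where
  refine_succ n x y hxy := by
    funext k
    have := congrFun hxy k
    by_cases hk : k < n
    · simp only [hk, Nat.lt_succ_of_lt hk, if_true, Option.some.injEq] at this ⊢
      exact h.refine_succ _ _ _ this
    · simp [hk]
  basis u := by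
    refine ⟨fun U => ⟨fun hU => ?_, ?_⟩⟩
    · rw [nhds_pi, Filter.mem_pi] at hU
      obtain ⟨I, hI, t, ht, htU⟩ := hU
      choose f hf using fun i => h.exists_cone (ht i) (i + 1)
      obtain ⟨N, hN⟩ := (hI.image f).bddAbove
      refine ⟨N, trivial, fun x hx => htU fun i hi => (hf i).2 _ ?_⟩
      have hfi : f i ≤ N := hN ⟨i, hi, rfl⟩
      have := congrFun hx i
      have hiN : i < N := lt_of_lt_of_le (hf i).1 hfi
      simp only [hiN, if_true, Option.some.injEq] at this
      exact h.mono hfi this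
    · rintro ⟨n, -, hn⟩
      have : ∀ᶠ x in 𝓝 u, ∀ k ∈ Finset.range n, c n (x k) = c n (u k) := by
        rw [Filter.eventually_all_finset]
        exact fun k _ => (continuous_apply k).continuousAt.eventually (h.eventually n (u k))
      filter_upwards [this] with x hx
      apply hn
      funext k
      by_cases hk : k < n
      · simp [hk, hx k (Finset.mem_range.2 hk)]
      · simp [hk]

end IsCode

namespace IsCode

variable {A D : Type*} [TopologicalSpace A] {c : ℕ → A → D}

theorem exists_level_on (h : IsCode c) {S : Set A} {Q : ℕ → D → Prop}
    (hQ : ∀ a ∈ S, ∃ n, Q n (c n a)) :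
    ∃ f : A → ℕ, ∀ a ∈ S, Q (f a) (c (f a) a) ∧ ∀ x, c (f a) x = c (f a) a → f x = f a := by
  refine ⟨fun a => sInf {n | Q n (c n a)}, fun a ha => ?_⟩
  have h1 : Q (sInf {n | Q n (c n a)}) (c (sInf {n | Q n (c n a)}) a) := Nat.sInf_mem (hQ a ha)
  refine ⟨h1, fun x hx => ?_⟩
  have hmem : sInf {n | Q n (c n a)} ∈ {n | Q n (c n x)} := by
    change Q _ _
    rw [hx]
    exact h1
  have hle := Nat.sInf_le hmem
  refine le_antisymm hle (Nat.sInf_le ?_)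
  have h2 : Q (sInf {n | Q n (c n x)}) (c (sInf {n | Q n (c n x)}) x) := Nat.sInf_mem ⟨_, hmem⟩
  rw [h.mono hle hx] at h2
  exact h2

end IsCode

/-- A continuous partial section `s` of `p` over `E`, together with an open set `M` lying over the
complement of `E` that shrinks to the values of `s` near `E`. -/
structure Pinched {A B : Type*} [TopologicalSpace A] [TopologicalSpace B] (p : A → B)
    (E : Set B) (s : B → A) (M : Set A) : Prop where
  isClosed : IsClosed E
  cont : ContinuousOn s E
  section_eq : ∀ b ∈ E, p (s b) = b
  isOpen : IsOpen M
  notMem : ∀ a ∈ M, p a ∉ E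
  surj : ∀ b ∉ E, ∃ a ∈ M, p a = b
  pinch : ∀ b ∈ E, ∀ O ∈ 𝓝 (s b), ∃ V ∈ 𝓝 b, ∀ a ∈ M, p a ∈ V → a ∈ O

/-- Over small pieces of `F` the map `p` has continuous sections through every open set. -/
def HasLocalSections {A B : Type*} [TopologicalSpace A] [TopologicalSpace B] (p : A → B)
    (F : Set B) : Prop :=
  ∀ a, ∀ O ∈ 𝓝 a, ∃ V ∈ 𝓝 (p a), ∃ s : B → A,
    ContinuousOn s (F ∩ V) ∧ ∀ b ∈ F ∩ V, p (s b) = b ∧ s b ∈ O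

section Fiber

variable {A B DA DB : Type*} [TopologicalSpace A] [TopologicalSpace B]
  {cA : ℕ → A → DA} {cB : ℕ → B → DB} {p : A → B}

theorem exists_pinched (hA : IsCode cA) (hB : IsCode cB) (hp : Continuous p) {E : Set B}
    (hE : IsClosed E) {s : B → A} (hs : ContinuousOn s E) (hps : ∀ b ∈ E, p (s b) = b)
    {M₀ : Set A} (hM₀ : IsOpen M₀) (hsurj : ∀ b ∉ E, ∃ a ∈ M₀, p a = b)
    (happ : ∀ b ∈ E, ∀ O ∈ 𝓝 (s b), ∃ V ∈ 𝓝 b, ∀ b' ∈ V, b' ∉ E → ∃ a ∈ M₀, a ∈ O ∧ p a = b') :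
    ∃ M ⊆ M₀, Pinched p E s M := by
  classical
  obtain ⟨good, hgood⟩ : ∃ good : ℕ → DB → ℕ → B → Prop, ∀ n d m e, good n d m e ↔
      (e ∈ E ∧ cB n e = d ∧
        ∀ b', cB n b' = d → b' ∉ E → ∃ a ∈ M₀, p a = b' ∧ cA m a = cA m (s e)) :=
    ⟨_, fun _ _ _ _ => Iff.rfl⟩
  have good_mono : ∀ n d m m' e, m' ≤ m → good n d m e → good n d m' e := by
    intro n d m m' e hm h
    rw [hgood] at h ⊢
    refine ⟨h.1, h.2.1, fun b' h1 h2 => ?_⟩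
    obtain ⟨a, h3, h4, h5⟩ := h.2.2 b' h1 h2
    exact ⟨a, h3, h4, hA.mono hm h5⟩
  have miss : ∀ b ∉ E, ∃ n, ∀ x, cB n x = cB n b → x ∉ E := by
    intro b hb
    obtain ⟨n, -, hn⟩ := hB.exists_cone (hE.isOpen_compl.mem_nhds hb) 0
    exact ⟨n, hn⟩
  let M : Set A := {a | a ∈ M₀ ∧ p a ∉ E ∧ ∀ n, (∃ e ∈ E, cB n e = cB n (p a)) →
    (∀ e ∈ E, cB (n + 1) e ≠ cB (n + 1) (p a)) → ∀ m ≤ n, (∃ e, good n (cB n (p a)) m e) →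
      ∃ e, good n (cB n (p a)) m e ∧ cA m a = cA m (s e)}
  refine ⟨M, fun a ha => ha.1, hE, hs, hps, ?_, fun a ha => ha.2.1, ?_, ?_⟩
  · rw [isOpen_iff_mem_nhds]
    intro a ha
    obtain ⟨N, hN⟩ := miss _ ha.2.1
    filter_upwards [hM₀.mem_nhds ha.1, hA.eventually N a,
      hp.continuousAt.eventually (hB.eventually N (p a))] with x h1 h2 h3
    refine ⟨h1, hN _ h3, fun n hn1 hn2 m hm hg => ?_⟩
    have hnN : n < N := by
      by_contra hlt
      push Not at hlt
      obtain ⟨e, he, he'⟩ := hn1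
      exact hN e ((hB.mono hlt he').trans h3) he
    have e1 : cB n (p x) = cB n (p a) := hB.mono hnN.le h3
    have e2 : cB (n + 1) (p x) = cB (n + 1) (p a) := hB.mono hnN h3
    rw [e1] at hn1 hg ⊢
    rw [e2] at hn2
    obtain ⟨e, he, he'⟩ := ha.2.2 n hn1 hn2 m hm hg
    exact ⟨e, he, (hA.mono (hm.trans hnN.le) h2).trans he'⟩
  · intro b hb
    by_cases hn : ∃ n, (∃ e ∈ E, cB n e = cB n b) ∧ (∀ e ∈ E, cB (n + 1) e ≠ cB (n + 1) b)
    swap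
    · obtain ⟨a, ha, rfl⟩ := hsurj b hb
      exact ⟨a, ⟨ha, hb, fun n h1 h2 => (hn ⟨n, h1, h2⟩).elim⟩, rfl⟩
    obtain ⟨n, ⟨e₀, he₀, he₀'⟩, hn2⟩ := hn
    have huniq : ∀ n', (∃ e ∈ E, cB n' e = cB n' b) →
        (∀ e ∈ E, cB (n' + 1) e ≠ cB (n' + 1) b) → n' = n := by
      rintro n' ⟨e, he, he'⟩ h2
      by_contra hne
      rcases lt_or_gt_of_ne hne with hlt | hlt
      · exact h2 e₀ he₀ (hB.mono hlt he₀')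
      · exact hn2 e he (hB.mono hlt he')
    by_cases hg : ∃ m ≤ n, ∃ e, good n (cB n b) m e
    swap
    · obtain ⟨a, ha, rfl⟩ := hsurj b hb
      refine ⟨a, ⟨ha, hb, fun n' h1 h2 m hm hge => ?_⟩, rfl⟩
      obtain rfl := huniq n' h1 h2
      exact (hg ⟨m, hm, hge⟩).elim
    obtain ⟨m₁, hm₁, hg₁⟩ := hg
    obtain ⟨e, he⟩ := Nat.findGreatest_spec (P := fun m => ∃ e, good n (cB n b) m e) hm₁ hg₁
    obtain ⟨a, ha, rfl, hae⟩ := ((hgood _ _ _ _).1 he).2.2 b rfl hb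
    refine ⟨a, ⟨ha, hb, fun n' h1 h2 m hm hge => ?_⟩, rfl⟩
    obtain rfl := huniq n' h1 h2
    have hle := Nat.le_findGreatest (P := fun m => ∃ e, good n' (cB n' (p a)) m e) hm hge
    exact ⟨e, good_mono _ _ _ _ _ hle he, hA.mono hle hae⟩
  · intro b hb O hO
    obtain ⟨m, -, hm⟩ := hA.exists_cone hO 0
    have hcont : ∀ᶠ e in 𝓝 b, e ∈ E → cA m (s e) = cA m (s b) :=
      eventually_nhdsWithin_iff.1 ((hs b hb).eventually (hA.eventually m (s b)))
    obtain ⟨n₁, hmn₁, hn₁⟩ := hB.exists_cone hcont m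
    obtain ⟨V, hV, hV'⟩ := happ b hb _ (hA.cone_mem m (s b))
    obtain ⟨n₂, hn₁₂, hn₂⟩ := hB.exists_cone hV n₁
    refine ⟨_, hB.cone_mem n₂ b, fun a ha hab => hm _ ?_⟩
    have hab' : cB n₂ (p a) = cB n₂ b := hab
    have hmiss : ∃ N, ∀ e ∈ E, cB N e ≠ cB N (p a) := by
      obtain ⟨N, hN⟩ := miss _ ha.2.1
      exact ⟨N, fun e he h => hN e h he⟩
    have hlt : n₂ < Nat.find hmiss := by
      by_contra hle
      push Not at hle
      exact Nat.find_spec hmiss b hb (hB.mono hle hab'.symm)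
    obtain ⟨n, hn⟩ := Nat.exists_eq_succ_of_ne_zero (Nat.ne_zero_of_lt hlt)
    have hn2n : n₂ ≤ n := by omega
    have hmeet : ∃ e ∈ E, cB n e = cB n (p a) := by
      have := Nat.find_min hmiss (m := n) (by omega)
      push Not at this
      exact this
    have hmiss' : ∀ e ∈ E, cB (n + 1) e ≠ cB (n + 1) (p a) := by
      have := Nat.find_spec hmiss
      rwa [hn] at this
    have hin : ∀ x, cB n x = cB n (p a) → cB n₂ x = cB n₂ b := fun x hx =>
      (hB.mono hn2n hx).trans hab'
    have hgm : ∃ e, good n (cB n (p a)) m e := by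
      obtain ⟨e, he, he'⟩ := hmeet
      refine ⟨e, (hgood _ _ _ _).2 ⟨he, he', fun b' hb' hb'E => ?_⟩⟩
      obtain ⟨x, hx, hx1, hx2⟩ := hV' b' (hn₂ _ (hin _ hb')) hb'E
      refine ⟨x, hx, hx2, ?_⟩
      have : cA m x = cA m (s b) := hx1
      rw [this, hn₁ e (hB.mono hn₁₂ (hin _ he')) he]
    obtain ⟨e, he, hae⟩ := ha.2.2 n hmeet hmiss' m (by omega) hgm
    obtain ⟨heE, hec, -⟩ := (hgood _ _ _ _).1 he
    rw [hae, hn₁ e (hB.mono hn₁₂ (hin _ hec)) heE]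

theorem Pinched.extend (hA : IsCode cA) (hB : IsCode cB) (hp : Continuous p) (hpo : IsOpenMap p)
    {E F : Set B} {s : B → A} {M : Set A} (h : Pinched p E s M) (hF : IsClosed F)
    (hsec : HasLocalSections p F) :
    ∃ s' M', Pinched p (E ∪ F) s' M' ∧ M' ⊆ M ∧ (∀ b ∈ E, s' b = s b) ∧
      ∀ b ∈ F, b ∉ E → s' b ∈ M := by
  classical
  let Q : ℕ → DB → Prop := fun n d => (∀ e ∈ E, cB n e ≠ d) ∧
    ∃ σ : B → A, ContinuousOn σ (F ∩ {x | cB n x = d}) ∧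
      ∀ x ∈ F ∩ {x | cB n x = d}, p (σ x) = x ∧ σ x ∈ M
  have hQ : ∀ b ∈ Eᶜ, ∃ n, Q n (cB n b) := by
    intro b hb
    obtain ⟨a, ha, rfl⟩ := h.surj b hb
    obtain ⟨V, hV, σ, hσ, hσ'⟩ := hsec a M (h.isOpen.mem_nhds ha)
    obtain ⟨n, -, hn⟩ := hB.exists_cone
      (Filter.inter_mem hV (h.isClosed.isOpen_compl.mem_nhds hb)) 0
    have hsub : F ∩ {x | cB n x = cB n (p a)} ⊆ F ∩ V :=
      inter_subset_inter_right _ fun x hx => (hn x hx).1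
    exact ⟨n, fun e he hec => (hn e hec).2 he, σ, hσ.mono hsub, fun x hx => hσ' x (hsub hx)⟩
  obtain ⟨lev, hlev⟩ := hB.exists_level_on hQ
  have hch : ∀ n d, ∃ σ : B → A, Q n d → ContinuousOn σ (F ∩ {x | cB n x = d}) ∧
      ∀ x ∈ F ∩ {x | cB n x = d}, p (σ x) = x ∧ σ x ∈ M := by
    intro n d
    by_cases hq : Q n d
    · obtain ⟨-, σ, hσ⟩ := hq
      exact ⟨σ, fun _ => hσ⟩
    · exact ⟨s, fun h => (hq h).elim⟩
  choose σ hσ using hch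
  let s' : B → A := fun b => if b ∈ E then s b else σ (lev b) (cB (lev b) b) b
  have hsE : ∀ b ∈ E, s' b = s b := fun b hb => if_pos hb
  have hsF : ∀ b ∉ E, s' b = σ (lev b) (cB (lev b) b) b := fun b hb => if_neg hb
  have hsM : ∀ b ∈ F, b ∉ E → p (s' b) = b ∧ s' b ∈ M := by
    intro b hbF hbE
    rw [hsF b hbE]
    exact (hσ _ _ (hlev b hbE).1).2 b ⟨hbF, rfl⟩
  have hps : ∀ b ∈ E ∪ F, p (s' b) = b := by
    intro b hb
    by_cases hbE : b ∈ E
    · rw [hsE b hbE, h.section_eq b hbE]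
    · exact (hsM b (hb.resolve_left hbE) hbE).1
  have hcont : ContinuousOn s' (E ∪ F) := by
    intro b hb
    by_cases hbE : b ∈ E
    · intro O hO
      rw [hsE b hbE] at hO
      obtain ⟨V, hV, hVO⟩ := h.pinch b hbE O hO
      have h1 := eventually_nhdsWithin_iff.1 (h.cont b hbE hO)
      refine eventually_nhdsWithin_iff.2 ?_
      filter_upwards [hV, h1] with x hxV hx1 hx
      by_cases hxE : x ∈ E
      · rw [hsE x hxE]
        exact hx1 hxE
      · obtain ⟨h2, h3⟩ := hsM x (hx.resolve_left hxE) hxE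
        exact hVO _ h3 (by rwa [h2])
    · obtain ⟨hq, hl⟩ := hlev b hbE
      have hbF := hb.resolve_left hbE
      have hc := (hσ _ _ hq).1 b ⟨hbF, rfl⟩
      have hc' : ContinuousWithinAt (σ (lev b) (cB (lev b) b)) F b :=
        (continuousWithinAt_inter (hB.cone_mem (lev b) b)).1 hc
      have hev : ∀ᶠ x in 𝓝 b, x ∉ E ∧ s' x = σ (lev b) (cB (lev b) b) x := by
        filter_upwards [hB.cone_mem (lev b) b] with x hx
        have hxE : x ∉ E := fun hxE => hq.1 x hxE hx
        refine ⟨hxE, ?_⟩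
        have hx' : cB (lev b) x = cB (lev b) b := hx
        rw [hsF x hxE, hl x hx, hx']
      intro O hO
      rw [hsF b hbE] at hO
      have h1 := eventually_nhdsWithin_iff.1 (hc' hO)
      refine eventually_nhdsWithin_iff.2 ?_
      filter_upwards [hev, h1] with x hx hx1 hxu
      rw [hx.2]
      exact hx1 (hxu.resolve_left hx.1)
  obtain ⟨M', hM', hpin⟩ := exists_pinched hA hB hp (h.isClosed.union hF) hcont hps h.isOpen
    (fun b hb => h.surj b fun hbE => hb (Or.inl hbE)) (by
      intro b hb O hO
      by_cases hbE : b ∈ E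
      · rw [hsE b hbE] at hO
        obtain ⟨V, hV, hVO⟩ := h.pinch b hbE O hO
        refine ⟨V, hV, fun b' hb' hb'E => ?_⟩
        obtain ⟨a, ha, rfl⟩ := h.surj b' fun hb'' => hb'E (Or.inl hb'')
        exact ⟨a, ha, hVO a ha hb', rfl⟩
      · obtain ⟨h2, h3⟩ := hsM b (hb.resolve_left hbE) hbE
        have := hpo.image_mem_nhds (Filter.inter_mem (h.isOpen.mem_nhds h3) hO)
        rw [h2] at this
        refine ⟨_, this, ?_⟩
        rintro _ ⟨a, ⟨ha1, ha2⟩, rfl⟩ -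
        exact ⟨a, ha1, ha2, rfl⟩)
  exact ⟨s', M', hpin, hM', hsE, fun b h1 h2 => (hsM b h1 h2).2⟩

theorem exists_global_section (hA : IsCode cA) (hB : IsCode cB) (hp : Continuous p)
    (hpo : IsOpenMap p) {BB : ℕ → Set B} (hBB : ∀ j, IsClosed (BB j)) (hcov : ∀ b, ∃ j, b ∈ BB j)
    (hsec : ∀ j, HasLocalSections p (BB j)) {A' : Set A} (hA' : IsOpen A')
    (hsurj : ∀ b, ∃ a ∈ A', p a = b) {D : Set B} (hD : IsClosed D) {s₀ : B → A}
    (hs₀ : ContinuousOn s₀ D) (hs₀' : ∀ b ∈ D, p (s₀ b) = b ∧ s₀ b ∈ A') :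
    ∃ s : B → A, Continuous s ∧ (∀ b, p (s b) = b ∧ s b ∈ A') ∧ ∀ b ∈ D, s b = s₀ b := by
  classical
  obtain ⟨E, rfl, hE⟩ : ∃ E : ℕ → Set B, E 0 = D ∧ ∀ j, E (j + 1) = E j ∪ BB j :=
    ⟨fun j => Nat.rec D (fun i S => S ∪ BB i) j, rfl, fun _ => rfl⟩
  obtain ⟨M₀, hM₀, hpin₀⟩ := exists_pinched hA hB hp hD hs₀ (fun b hb => (hs₀' b hb).1) hA'
    (fun b _ => hsurj b) (by
      intro b hb O hO
      have := hpo.image_mem_nhds (Filter.inter_mem (hA'.mem_nhds (hs₀' b hb).2) hO)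
      rw [(hs₀' b hb).1] at this
      refine ⟨_, this, ?_⟩
      rintro _ ⟨a, ⟨ha1, ha2⟩, rfl⟩ -
      exact ⟨a, ha1, ha2, rfl⟩)
  have hstep : ∀ j (q : {q : (B → A) × Set A // Pinched p (E j) q.1 q.2}),
      ∃ q' : {q : (B → A) × Set A // Pinched p (E (j + 1)) q.1 q.2}, q'.1.2 ⊆ q.1.2 ∧
        (∀ b ∈ E j, q'.1.1 b = q.1.1 b) ∧ ∀ b ∈ BB j, b ∉ E j → q'.1.1 b ∈ q.1.2 := by
    rintro j ⟨⟨s, M⟩, hq⟩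
    obtain ⟨s', M', h1, h2, h3, h4⟩ := hq.extend hA hB hp hpo (hBB j) (hsec j)
    rw [← hE] at h1
    exact ⟨⟨⟨s', M'⟩, h1⟩, h2, h3, h4⟩
  choose next hnext using hstep
  let st : ∀ j, {q : (B → A) × Set A // Pinched p (E j) q.1 q.2} :=
    fun j => Nat.rec ⟨⟨s₀, M₀⟩, hpin₀⟩ (fun i q => next i q) j
  have hst : ∀ j, st (j + 1) = next j (st j) := fun j => rfl
  have hEmono : Monotone E := monotone_nat_of_le_succ fun j => by
    rw [hE]
    exact subset_union_left
  have hMmono : Antitone fun j => (st j).1.2 := antitone_nat_of_succ_le fun j => by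
    rw [hst]
    exact (hnext j (st j)).1
  have hagree : ∀ i j, i ≤ j → ∀ b ∈ E i, (st j).1.1 b = (st i).1.1 b := by
    intro i j hij b hb
    induction hij with
    | refl => rfl
    | step hij ih => rw [hst, (hnext _ _).2.1 b (hEmono hij hb), ih]
  have hex : ∀ b, ∃ j, b ∈ E j := fun b => by
    obtain ⟨j, hj⟩ := hcov b
    exact ⟨j + 1, by rw [hE]; exact Or.inr hj⟩
  let s : B → A := fun b => (st (Nat.find (hex b))).1.1 b
  have hs : ∀ j, ∀ b ∈ E j, s b = (st j).1.1 b := fun j b hb =>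
    (hagree _ _ (Nat.find_min' (hex b) hb) b (Nat.find_spec (hex b))).symm
  have hsM : ∀ j, ∀ b ∉ E j, s b ∈ (st j).1.2 := by
    intro j b hb
    have hlt : j < Nat.find (hex b) := by
      by_contra hle
      push Not at hle
      exact hb (hEmono hle (Nat.find_spec (hex b)))
    obtain ⟨i, hi⟩ := Nat.exists_eq_succ_of_ne_zero (Nat.ne_zero_of_lt hlt)
    have hi1 : b ∉ E i := Nat.find_min (hex b) (show i < Nat.find (hex b) by omega)
    have hi2 : b ∈ E (i + 1) := by
      have := Nat.find_spec (hex b)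
      rwa [hi] at this
    have hji : j ≤ i := by omega
    rw [hs _ b hi2, hst]
    rw [hE] at hi2
    exact hMmono hji ((hnext i (st i)).2.2 b (hi2.resolve_left hi1) hi1)
  have hsD : ∀ b ∈ E 0, s b = s₀ b := fun b hb => hs 0 b hb
  refine ⟨s, ?_, fun b => ⟨?_, ?_⟩, hsD⟩
  · rw [continuous_iff_continuousAt]
    intro b
    obtain ⟨j, hj⟩ := hex b
    intro O hO
    rw [hs j b hj] at hO
    obtain ⟨V, hV, hVO⟩ := (st j).2.pinch b hj O hO
    have h1 := eventually_nhdsWithin_iff.1 ((st j).2.cont b hj hO)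
    rw [Filter.mem_map]
    filter_upwards [hV, h1] with x hxV hx1
    by_cases hx : x ∈ E j
    · rw [mem_preimage, hs j x hx]
      exact hx1 hx
    · refine hVO _ (hsM j x hx) ?_
      obtain ⟨i, hi⟩ := hex x
      rw [hs i x hi, (st i).2.section_eq x hi]
      exact hxV
  · obtain ⟨j, hj⟩ := hex b
    rw [hs j b hj, (st j).2.section_eq b hj]
  · by_cases hb : b ∈ E 0
    · rw [hsD b hb]
      exact (hs₀' b hb).2
    · exact hM₀ (hsM 0 b hb)

end Fiber

/-- Eventually vanishing binary sequences, a copy of the rationals. -/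
def BinFin : Type := {t : ℕ → Bool // ∃ m, ∀ n ≥ m, t n = false}

instance : TopologicalSpace BinFin := instTopologicalSpaceSubtype

section Fiber

variable {A B DA DB : Type*} [TopologicalSpace A] [TopologicalSpace B]
  {cA : ℕ → A → DA} {cB : ℕ → B → DB} {p : A → B}

/-- A clopen set together with a global section into it. -/
def ClopenSection (p : A → B) : Type _ :=
  {q : Set A × (B → A) // IsClopen q.1 ∧ Continuous q.2 ∧ ∀ b, p (q.2 b) = b ∧ q.2 b ∈ q.1}

/-- Data on `p : A → B` from which a fibrewise homeomorphism with `B × BinFin` is constructed. -/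
structure FiberData (cA : ℕ → A → DA) (cB : ℕ → B → DB) (p : A → B) (BB E : ℕ → Set B)
    (σ : ℕ → B → A) : Prop where
  codeA : IsCode cA
  codeB : IsCode cB
  cont : Continuous p
  isOpenMap : IsOpenMap p
  surj : Function.Surjective p
  perfect : ∀ a, ∀ O ∈ 𝓝 a, ∃ a' ∈ O, a' ≠ a ∧ p a' = p a
  closed : ∀ j, IsClosed (BB j)
  cover : ∀ b, ∃ j, b ∈ BB j
  sections : ∀ j, HasLocalSections p (BB j)
  closedE : ∀ k, IsClosed (E k)
  contσ : ∀ k, ContinuousOn (σ k) (E k)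
  section_eq : ∀ k, ∀ b ∈ E k, p (σ k b) = b
  exhaust : ∀ a, ∃ k, p a ∈ E k ∧ σ k (p a) = a

theorem FiberData.exists_section_into {BB E : ℕ → Set B} {σ : ℕ → B → A}
    (h : FiberData cA cB p BB E σ) {A' : Set A} (hA' : IsClopen A')
    (hsurj : ∀ b, ∃ a ∈ A', p a = b) (k : ℕ) :
    ∃ s : B → A, Continuous s ∧ (∀ b, p (s b) = b ∧ s b ∈ A') ∧
      ∀ b ∈ E k, σ k b ∈ A' → s b = σ k b := by
  obtain ⟨s, h1, h2, h3⟩ := exists_global_section h.codeA h.codeB h.cont h.isOpenMap h.closed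
    h.cover h.sections hA'.isOpen hsurj
    ((h.contσ k).preimage_isClosed_of_isClosed (h.closedE k) hA'.isClosed)
    ((h.contσ k).mono inter_subset_left) (fun b hb => ⟨h.section_eq k b hb.1, hb.2⟩)
  exact ⟨s, h1, h2, fun b hb hb' => h3 b ⟨hb, hb'⟩⟩

theorem FiberData.exists_split [T1Space A] {BB E : ℕ → Set B} {σ : ℕ → B → A}
    (h : FiberData cA cB p BB E σ) (q : ClopenSection p) (k l : ℕ) :
    ∃ q₀ q₁ : ClopenSection p, q₀.1.2 = q.1.2 ∧ q₁.1.1 = q.1.1 \ q₀.1.1 ∧ q₀.1.1 ⊆ q.1.1 ∧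
      (∀ a ∈ q₀.1.1, cA l a = cA l (q.1.2 (p a))) ∧
      ∀ b ∈ E k, σ k b ∈ q₁.1.1 → q₁.1.2 b = σ k b := by
  obtain ⟨⟨A', s⟩, hA', hs, hps⟩ := q
  dsimp only at hA' hs hps ⊢
  have hlev : ∀ b, ∃ n, ∀ x, cB n x = cB n b →
      l ≤ n ∧ ∃ a ∈ A', p a = x ∧ cA n a ≠ cA n (s x) := by
    intro b
    obtain ⟨a', ha', hne, hpa⟩ := h.perfect (s b) A' (hA'.isOpen.mem_nhds (hps b).2)
    rw [(hps b).1] at hpa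
    obtain ⟨m, hm⟩ : ∃ m, cA m a' ≠ cA m (s b) := by
      by_contra hcon
      push Not at hcon
      exact hne (h.codeA.eq_of_forall hcon)
    have h1 := h.isOpenMap.image_mem_nhds
      (Filter.inter_mem (hA'.isOpen.mem_nhds ha') (h.codeA.cone_mem m a'))
    rw [hpa] at h1
    have h2 := hs.continuousAt.eventually (h.codeA.eventually m (s b))
    obtain ⟨n, hn, hn'⟩ := h.codeB.exists_cone (Filter.inter_mem h1 h2) (max l m)
    refine ⟨n, fun x hx => ⟨(le_max_left _ _).trans hn, ?_⟩⟩
    obtain ⟨⟨a, ⟨ha, ham⟩, rfl⟩, hx2⟩ := hn' x hx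
    refine ⟨a, ha, rfl, fun hcon => hm ?_⟩
    have ham' : cA m a = cA m a' := ham
    have hx2' : cA m (s (p a)) = cA m (s b) := hx2
    rw [← ham', ← hx2']
    exact h.codeA.mono ((le_max_right _ _).trans hn) hcon
  obtain ⟨f, hf, hf'⟩ := h.codeB.exists_level hlev
  let C : Set A := {a | cA (f (p a)) a = cA (f (p a)) (s (p a))}
  have hloc : ∀ a, ∀ᶠ x in 𝓝 a, (x ∈ C ↔ a ∈ C) := by
    intro a
    filter_upwards [h.cont.continuousAt.eventually (h.codeB.eventually (f (p a)) (p a)),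
      h.codeA.eventually (f (p a)) a,
      (hs.comp h.cont).continuousAt.eventually (h.codeA.eventually (f (p a)) (s (p a)))]
      with x h1 h2 h3
    have h4 : f (p x) = f (p a) := hf _ _ h1
    have h3' : cA (f (p a)) (s (p x)) = cA (f (p a)) (s (p a)) := h3
    simp only [C, mem_ofPred_eq]
    rw [h4, h2, h3']
  have hC : IsClopen C := by
    constructor
    · rw [← isOpen_compl_iff, isOpen_iff_mem_nhds]
      intro a ha
      filter_upwards [hloc a] with x hx
      exact fun hxC => ha (hx.1 hxC)
    · rw [isOpen_iff_mem_nhds]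
      intro a ha
      filter_upwards [hloc a] with x hx using hx.2 ha
  have hsC : ∀ b, s b ∈ C := fun b => by simp only [C, mem_ofPred_eq, (hps b).1]
  obtain ⟨s', hs', hps', hcov⟩ := h.exists_section_into (hA'.diff (hA'.inter hC))
    (fun b => by
      obtain ⟨-, a, ha, rfl, hne⟩ := hf' b
      exact ⟨a, ⟨ha, fun hx => hne hx.2⟩, rfl⟩) k
  exact ⟨⟨⟨A' ∩ C, s⟩, hA'.inter hC, hs, fun b => ⟨(hps b).1, (hps b).2, hsC b⟩⟩,
    ⟨⟨A' \ (A' ∩ C), s'⟩, hA'.diff (hA'.inter hC), hs', hps'⟩, rfl, rfl, inter_subset_left,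
    fun a ha => h.codeA.mono (hf' (p a)).1 ha.2, hcov⟩

/-- The initial segments of a binary sequence, most recent entry first. -/
def initSeg (t : ℕ → Bool) : ℕ → List Bool
  | 0 => []
  | n + 1 => t n :: initSeg t n

theorem length_initSeg (t : ℕ → Bool) (n : ℕ) : (initSeg t n).length = n := by
  induction n with
  | zero => rfl
  | succ n ih => simp [initSeg, ih]

theorem initSeg_congr {t t' : ℕ → Bool} {n : ℕ} (h : ∀ k < n, t k = t' k) :
    initSeg t n = initSeg t' n := by
  induction n with
  | zero => rfl
  | succ n ih => simp [initSeg, ih fun k hk => h k (by omega), h n (by omega)]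

theorem eventually_false_of_count_le {t : ℕ → Bool} {k : ℕ}
    (h : ∀ n, (initSeg t n).count true ≤ k) : ∃ m, ∀ n ≥ m, t n = false := by
  by_contra hcon
  push Not at hcon
  have hstep : ∀ j, ∃ n, j ≤ (initSeg t n).count true := by
    intro j
    induction j with
    | zero => exact ⟨0, Nat.zero_le _⟩
    | succ j ih =>
      obtain ⟨n, hn⟩ := ih
      obtain ⟨m, hm, ht⟩ := hcon n
      have hmono : ∀ i, (initSeg t n).count true ≤ (initSeg t (n + i)).count true := by
        intro i
        induction i with
        | zero => exact le_rfl
        | succ i ih => exact ih.trans (by rw [← add_assoc, initSeg, List.count_cons]; omega)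
      obtain ⟨i, rfl⟩ := Nat.exists_eq_add_of_le hm
      refine ⟨n + i + 1, ?_⟩
      rw [initSeg, Bool.eq_true_of_not_eq_false ht, List.count_cons_self]
      have := hmono i
      omega
  obtain ⟨n, hn⟩ := hstep (k + 1)
  have := h n
  omega

theorem FiberData.exists_homeomorph [T1Space A] {BB E : ℕ → Set B} {σ : ℕ → B → A}
    (h : FiberData cA cB p BB E σ) : ∃ φ : A ≃ₜ B × BinFin, ∀ a, (φ a).1 = p a := by
  classical
  choose q₀ q₁ hq₀ hq₁ hsub hclose hcov using h.exists_split
  obtain ⟨r, hr, hr', hr''⟩ := h.exists_section_into isClopen_univ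
    (fun b => by obtain ⟨a, ha⟩ := h.surj b; exact ⟨a, mem_univ _, ha⟩) 0
  let root : ClopenSection p := ⟨⟨univ, r⟩, isClopen_univ, hr, hr'⟩
  let T : List Bool → ClopenSection p := fun w => List.rec root
    (fun b w q => if b then q₁ q (w.count true + 1) w.length else
      q₀ q (w.count true + 1) w.length) w
  have hTf : ∀ w, T (false :: w) = q₀ (T w) (w.count true + 1) w.length := fun w => rfl
  have hTt : ∀ w, T (true :: w) = q₁ (T w) (w.count true + 1) w.length := fun w => rfl
  have hTs : ∀ w, (T (false :: w)).1.2 = (T w).1.2 := fun w => by rw [hTf]; exact hq₀ _ _ _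
  have hTd : ∀ w, (T (true :: w)).1.1 = (T w).1.1 \ (T (false :: w)).1.1 := fun w => by
    rw [hTf, hTt]; exact hq₁ _ _ _
  have hTsub : ∀ x w, (T (x :: w)).1.1 ⊆ (T w).1.1 := by
    intro x w
    cases x
    · rw [hTf]; exact hsub _ _ _
    · rw [hTd]; exact sdiff_subset
  have hTc : ∀ w, ∀ a ∈ (T (false :: w)).1.1, cA w.length a = cA w.length ((T w).1.2 (p a)) :=
    fun w a ha => by rw [hTf] at ha; exact hclose _ _ _ a ha
  have hTcov : ∀ w, ∀ b ∈ E (w.count true + 1), σ (w.count true + 1) b ∈ (T (true :: w)).1.1 →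
      (T (true :: w)).1.2 b = σ (w.count true + 1) b := fun w b hb hb' => by
    rw [hTt] at hb' ⊢; exact hcov _ _ _ b hb hb'
  have hps : ∀ w b, p ((T w).1.2 b) = b := fun w b => ((T w).2.2.2 b).1
  have hsm : ∀ w b, (T w).1.2 b ∈ (T w).1.1 := fun w b => ((T w).2.2.2 b).2
  -- the address of a point
  let seg : A → ℕ → List Bool := fun a m => Nat.rec []
    (fun _ w => (if a ∈ (T (false :: w)).1.1 then false else true) :: w) m
  let bit : A → ℕ → Bool := fun a m => if a ∈ (T (false :: seg a m)).1.1 then false else true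
  have hseg : ∀ a m, seg a m = initSeg (bit a) m := by
    intro a m
    induction m with
    | zero => rfl
    | succ m ih =>
      rw [initSeg, ← ih]
  have hbit : ∀ a m, bit a m = false ↔ a ∈ (T (false :: initSeg (bit a) m)).1.1 := by
    intro a m
    rw [← hseg]
    by_cases ha : a ∈ (T (false :: seg a m)).1.1 <;> simp [bit, ha]
  have hmemT : ∀ a m, a ∈ (T (initSeg (bit a) m)).1.1 := by
    intro a m
    induction m with
    | zero => exact mem_univ a
    | succ m ih =>
      rw [initSeg]
      cases hb : bit a m
      · exact (hbit a m).1 hb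
      · rw [hTd]
        refine ⟨ih, fun hc => ?_⟩
        rw [(hbit a m).2 hc] at hb
        exact Bool.false_ne_true hb
  have haddr : ∀ a (t : ℕ → Bool) m, a ∈ (T (initSeg t m)).1.1 → ∀ k < m, bit a k = t k := by
    intro a t m ha
    induction m with
    | zero => intro k hk; omega
    | succ m ih =>
      have ih' := ih (hTsub _ _ ha)
      intro k hk
      rcases Nat.lt_succ_iff_lt_or_eq.1 hk with hk | rfl
      · exact ih' k hk
      · rw [initSeg, ← initSeg_congr ih'] at ha
        cases ht : t k
        · rw [ht] at ha
          exact (hbit a k).2 ha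
        · rw [ht, hTd] at ha
          cases hb : bit a k
          · exact (ha.2 ((hbit a k).1 hb)).elim
          · rfl
  have hfin : ∀ a, ∃ m, ∀ n ≥ m, bit a n = false := by
    intro a
    obtain ⟨k, hk, hka⟩ := h.exhaust a
    have key : ∀ n, (initSeg (bit a) n).count true ≤ k ∧
        ((initSeg (bit a) n).count true = k → (T (initSeg (bit a) n)).1.2 (p a) = a) := by
      intro n
      induction n with
      | zero =>
        refine ⟨Nat.zero_le _, fun h0 => ?_⟩
        obtain rfl : 0 = k := h0
        exact (hr'' _ hk (mem_univ _)).trans hka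
      | succ n ih =>
        cases hb : bit a n
        · rw [initSeg, hb, List.count_cons_of_ne (by decide), hTs]
          exact ih
        · have hne : (initSeg (bit a) n).count true ≠ k := by
            intro hc
            have h1 := hsm (false :: initSeg (bit a) n) (p a)
            rw [hTs, ih.2 hc, ← hbit, hb] at h1
            exact Bool.false_ne_true h1.symm
          rw [initSeg, hb, List.count_cons_self]
          refine ⟨by omega, fun hc => ?_⟩
          have hmem := hmemT a (n + 1)
          rw [initSeg, hb] at hmem
          rw [hTcov _ _ (hc ▸ hk), hc, hka]
          rw [hc, hka]
          exact hmem
    exact eventually_false_of_count_le fun n => (key n).1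
  have hstab : ∀ (t : ℕ → Bool) m, (∀ n ≥ m, t n = false) → ∀ n ≥ m,
      (T (initSeg t n)).1.2 = (T (initSeg t m)).1.2 := by
    intro t m hm n hn
    induction hn with
    | refl => rfl
    | step hn ih => rw [initSeg, hm _ hn, hTs, ih]
  let inv : B × BinFin → A := fun x => (T (initSeg x.2.1 x.2.2.choose)).1.2 x.1
  have hinv : ∀ (x : B × BinFin), ∀ m ≥ x.2.2.choose, inv x = (T (initSeg x.2.1 m)).1.2 x.1 :=
    fun x m hm => congrFun (hstab x.2.1 _ x.2.2.choose_spec m hm).symm x.1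
  have hinvp : ∀ x, p (inv x) = x.1 := fun x => hps _ _
  have hTanti : ∀ t : ℕ → Bool, Antitone fun m => (T (initSeg t m)).1.1 := fun t =>
    antitone_nat_of_succ_le fun m => hTsub _ _
  have hinvT : ∀ (x : B × BinFin) m, inv x ∈ (T (initSeg x.2.1 m)).1.1 := by
    intro x m
    apply hTanti x.2.1 (le_max_left m x.2.2.choose)
    rw [hinv x _ (le_max_right m x.2.2.choose)]
    exact hsm _ _
  have hinvbit : ∀ (x : B × BinFin), bit (inv x) = x.2.1 := fun x => funext fun k =>
    haddr _ _ (k + 1) (hinvT x (k + 1)) k (Nat.lt_succ_self k)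
  have hinj : ∀ a a', p a = p a' → bit a = bit a' → a = a' := by
    intro a a' hp hb
    obtain ⟨m, hm⟩ := hfin a
    apply h.codeA.eq_of_forall
    intro n
    have h1 := (hbit a (max m n)).1 (hm _ (le_max_left _ _))
    have h2 := (hbit a' (max m n)).1 (hb ▸ hm _ (le_max_left _ _))
    have h3 := hTc _ a h1
    have h4 := hTc _ a' h2
    rw [length_initSeg] at h3 h4
    rw [← hp, ← hb] at h4
    exact h.codeA.mono (le_max_right m n) (h3.trans h4.symm)
  let φ : A ≃ B × BinFin :=
    { toFun := fun a => (p a, ⟨bit a, hfin a⟩)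
      invFun := inv
      left_inv := fun a => hinj _ _ (hinvp _) (hinvbit _)
      right_inv := fun x => Prod.ext (hinvp x) (Subtype.ext (hinvbit x)) }
  refine ⟨⟨φ, ?_, ?_⟩, fun a => rfl⟩
  · refine h.cont.prodMk (Continuous.subtype_mk (continuous_pi fun m => ?_) _)
    rw [continuous_iff_continuousAt]
    intro a
    refine ContinuousAt.congr (f := fun _ => bit a m) continuousAt_const ?_
    filter_upwards [(T (initSeg (bit a) (m + 1))).2.1.isOpen.mem_nhds (hmemT a (m + 1))]
      with x hx
    exact (haddr x _ _ hx m (Nat.lt_succ_self m)).symm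
  · rw [continuous_iff_continuousAt]
    rintro x
    change Filter.Tendsto inv (𝓝 x) (𝓝 (inv x))
    rw [(h.codeA.basis (inv x)).tendsto_right_iff]
    rintro n -
    obtain ⟨m, hmn, hmc⟩ : ∃ m, n ≤ m ∧ x.2.2.choose ≤ m :=
      ⟨max n x.2.2.choose, le_max_left _ _, le_max_right _ _⟩
    have hs : ContinuousAt (fun y : B × BinFin => (T (initSeg x.2.1 m)).1.2 y.1) x :=
      ((T (initSeg x.2.1 m)).2.2.1.comp continuous_fst).continuousAt
    have h1 := hs.eventually (h.codeA.eventually m _)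
    have h2 : ∀ᶠ y : B × BinFin in 𝓝 x, ∀ k ∈ Finset.range (m + 1), y.2.1 k = x.2.1 k := by
      rw [Filter.eventually_all_finset]
      intro k _
      have hc : Continuous fun y : B × BinFin => y.2.1 k :=
        (continuous_apply k).comp (continuous_subtype_val.comp continuous_snd)
      exact hc.continuousAt.eventually (eventually_nhds_iff.2
        ⟨{x.2.1 k}, fun _ h => h, isOpen_discrete _, rfl⟩)
    filter_upwards [h1, h2] with y hy1 hy2
    have hy3 := hinvT y (m + 1)
    rw [initSeg_congr (t' := x.2.1) (fun k hk => hy2 k (Finset.mem_range.2 hk)), initSeg,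
      x.2.2.choose_spec m hmc] at hy3
    have hy4 := hTc _ _ hy3
    rw [length_initSeg, hinvp] at hy4
    change cA n (inv y) = cA n (inv x)
    apply h.codeA.mono hmn
    rw [hy4, hinv x m hmc]
    exact hy1

end Fiber

theorem exists_fiber_homeomorph_of_countable {A B DA DB : Type*} [TopologicalSpace A]
    [TopologicalSpace B] {cA : ℕ → A → DA} {cB : ℕ → B → DB} {p : A → B} [T1Space A] [T1Space B]
    [Countable A] [Nonempty A] (hA : IsCode cA) (hB : IsCode cB) (hp : Continuous p)
    (hpo : IsOpenMap p) (hsurj : Function.Surjective p)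
    (hperf : ∀ a, ∀ O ∈ 𝓝 a, ∃ a' ∈ O, a' ≠ a ∧ p a' = p a) :
    ∃ φ : A ≃ₜ B × BinFin, ∀ a, (φ a).1 = p a := by
  obtain ⟨e, he⟩ := exists_surjective_nat A
  refine FiberData.exists_homeomorph (cA := cA) (cB := cB) (BB := fun j => {p (e j)})
    (E := fun k => {p (e k)}) (σ := fun k _ => e k)
    { codeA := hA
      codeB := hB
      cont := hp
      isOpenMap := hpo
      surj := hsurj
      perfect := hperf
      closed := fun j => isClosed_singleton
      cover := fun b => by
        obtain ⟨a, rfl⟩ := hsurj b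
        obtain ⟨j, rfl⟩ := he a
        exact ⟨j, rfl⟩
      sections := fun j a O hO => by
        refine ⟨p '' O, hpo.image_mem_nhds hO, ?_⟩
        by_cases hj : p (e j) ∈ p '' O
        · obtain ⟨a', ha', hj⟩ := hj
          refine ⟨fun _ => a', continuousOn_const, ?_⟩
          rintro b ⟨rfl, -⟩
          exact ⟨hj, ha'⟩
        · refine ⟨fun _ => a, continuousOn_const, ?_⟩
          rintro b ⟨rfl, hb⟩
          exact (hj hb).elim
      closedE := fun k => isClosed_singleton
      contσ := fun k => continuousOn_const
      section_eq := fun k b hb => hb.symm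
      exhaust := fun a => by
        obtain ⟨k, rfl⟩ := he a
        exact ⟨k, rfl, rfl⟩ }

namespace BinFin

instance : Inhabited BinFin := ⟨⟨fun _ => false, 0, fun _ _ => rfl⟩⟩

instance : T2Space BinFin := inferInstanceAs (T2Space {t : ℕ → Bool // ∃ m, ∀ n ≥ m, t n = false})

instance : Countable BinFin := by
  refine Function.Injective.countable (β := Σ m : ℕ, Fin m → Bool)
    (f := fun t => ⟨t.2.choose, fun k => t.1 k⟩) ?_
  intro t t' h
  have h1 : t.2.choose = t'.2.choose := congrArg Sigma.fst h
  apply Subtype.ext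
  funext k
  by_cases hk : k < t.2.choose
  · have hk' : k < t'.2.choose := h1 ▸ hk
    have : ∀ x y : Σ m : ℕ, Fin m → Bool, x = y → ∀ (h1 : k < x.1) (h2 : k < y.1),
        x.2 ⟨k, h1⟩ = y.2 ⟨k, h2⟩ := by
      rintro x y rfl h1 h2
      rfl
    exact this _ _ h hk hk'
  · push Not at hk
    rw [t.2.choose_spec k hk, t'.2.choose_spec k (h1 ▸ hk)]

theorem isCode : IsCode (fun n (t : BinFin) (k : ℕ) => if k < n then some (t.1 k) else none) :=
  (IsCode.of_discrete Bool).pi.subtype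

theorem eventually_agree (t : BinFin) (m : ℕ) : ∀ᶠ t' : BinFin in 𝓝 t, ∀ k < m, t'.1 k = t.1 k := by
  filter_upwards [isCode.eventually m t] with t' h k hk
  simpa [hk] using congrFun h k

/-- One more than the position of the last nonzero entry. -/
def idx (t : BinFin) : ℕ := sInf {m | ∀ n ≥ m, t.1 n = false}

theorem idx_spec (t : BinFin) : ∀ n ≥ idx t, t.1 n = false := Nat.sInf_mem t.2

theorem lt_idx {t : BinFin} {n : ℕ} (h : t.1 n = true) : n < idx t := by
  by_contra hle
  push Not at hle
  rw [idx_spec t n hle] at h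
  exact Bool.false_ne_true h

theorem eventually_idx_le (t : BinFin) : ∀ᶠ t' in 𝓝 t, idx t ≤ idx t' := by
  filter_upwards [eventually_agree t (idx t)] with t' h
  by_contra hlt
  push Not at hlt
  have : idx t ≤ idx t' := by
    refine Nat.sInf_le fun n hn => ?_
    by_cases hn' : n < idx t
    · rw [← h n hn', idx_spec t' n hn]
    · exact idx_spec t n (not_lt.1 hn')
  omega

theorem exists_ne_idx_ge (t : BinFin) {O : Set BinFin} (hO : O ∈ 𝓝 t) (j : ℕ) :
    ∃ t' ∈ O, t' ≠ t ∧ j ≤ idx t' := by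
  obtain ⟨n, -, hn⟩ := isCode.exists_cone hO 0
  let m := max (max n j) (idx t)
  let t' : BinFin := ⟨Function.update t.1 m true, m + 1, fun k hk => by
    rw [Function.update_of_ne (by omega)]
    exact idx_spec t k (by omega)⟩
  have ht' : t'.1 m = true := Function.update_self ..
  refine ⟨t', hn _ ?_, fun h => ?_, ?_⟩
  · funext k
    by_cases hk : k < n
    · have : k ≠ m := by omega
      simp [hk, t', Function.update_of_ne this]
    · simp [hk]
  · rw [h, idx_spec t m (by omega)] at ht'
    exact Bool.false_ne_true ht'
  · have := lt_idx ht'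
    omega

end BinFin

/-- The domain of `N`, with the topology of the graph of `N`. -/
@[ext]
structure Gr {S : Type*} (N : S → ℝ) where
  /-- The underlying point. -/
  pt : S

namespace Gr

variable {S S' : Type*} [TopologicalSpace S] [TopologicalSpace S']

instance (N : S → ℝ) : TopologicalSpace (Gr N) :=
  TopologicalSpace.induced (fun x : Gr N => (x.pt, N x.pt)) inferInstance

theorem isInducing (N : S → ℝ) : IsInducing fun x : Gr N => (x.pt, N x.pt) := ⟨rfl⟩

theorem continuous_pt {N : S → ℝ} : Continuous (pt : Gr N → S) :=
  continuous_fst.comp (isInducing N).continuous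

theorem continuous_val {N : S → ℝ} : Continuous fun x : Gr N => N x.pt :=
  continuous_snd.comp (isInducing N).continuous

theorem continuous_mk {N : S → ℝ} {T : Type*} [TopologicalSpace T] {f : T → S} (hf : Continuous f)
    (hN : Continuous fun t => N (f t)) : Continuous fun t => (⟨f t⟩ : Gr N) :=
  (isInducing N).continuous_iff.2 (hf.prodMk hN)

/-- A homeomorphism changing the function by a continuous summand lifts to graphs. -/
def congr {N : S → ℝ} {N' : S' → ℝ} (φ : S ≃ₜ S') (h : Continuous fun s => N' (φ s) - N s) :
    Gr N ≃ₜ Gr N' where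
  toFun x := ⟨φ x.pt⟩
  invFun x := ⟨φ.symm x.pt⟩
  left_inv x := Gr.ext (φ.symm_apply_apply _)
  right_inv x := Gr.ext (φ.apply_symm_apply _)
  continuous_toFun := continuous_mk (φ.continuous.comp continuous_pt) (by
    have := (h.comp (continuous_pt (N := N))).add continuous_val
    refine this.congr fun x => ?_
    simp)
  continuous_invFun := continuous_mk (φ.symm.continuous.comp continuous_pt) (by
    have := (continuous_val (N := N')).sub
      ((h.comp φ.symm.continuous).comp (continuous_pt (N := N')))
    refine this.congr fun x => ?_
    simp)

theorem continuous_of_add {T : Type*} [TopologicalSpace T] {f g : T → ℝ}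
    (hf : LowerSemicontinuous f) (hg : LowerSemicontinuous g)
    (h : Continuous fun t => f t + g t) : Continuous f := by
  rw [continuous_iff_continuousAt]
  intro x
  rw [ContinuousAt, tendsto_order]
  refine ⟨fun a ha => hf x a ha, fun a ha => ?_⟩
  have h1 := hg x (g x - (a - f x) / 2) (by linarith)
  have h2 := (tendsto_order.1 (h.tendsto x)).2 (f x + g x + (a - f x) / 2) (by linarith)
  filter_upwards [h1, h2] with y h3 h4
  linarith

/-- Products of graphs of lower semicontinuous functions. -/
def prod {N : S → ℝ} {N' : S' → ℝ} (hN : LowerSemicontinuous N) (hN' : LowerSemicontinuous N') :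
    Gr N × Gr N' ≃ₜ Gr (fun x : S × S' => N x.1 + N' x.2) where
  toFun x := ⟨(x.1.pt, x.2.pt)⟩
  invFun x := (⟨x.pt.1⟩, ⟨x.pt.2⟩)
  left_inv x := rfl
  right_inv x := rfl
  continuous_toFun := continuous_mk
    ((continuous_pt.comp continuous_fst).prodMk (continuous_pt.comp continuous_snd))
    ((continuous_val.comp continuous_fst).add (continuous_val.comp continuous_snd))
  continuous_invFun := by
    have c1 : Continuous fun x : Gr (fun x : S × S' => N x.1 + N' x.2) => x.pt.1 :=
      continuous_fst.comp continuous_pt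
    have c2 : Continuous fun x : Gr (fun x : S × S' => N x.1 + N' x.2) => x.pt.2 :=
      continuous_snd.comp continuous_pt
    have h1 : LowerSemicontinuous fun x : Gr (fun x : S × S' => N x.1 + N' x.2) => N x.pt.1 :=
      hN.comp c1
    have h2 : LowerSemicontinuous fun x : Gr (fun x : S × S' => N x.1 + N' x.2) => N' x.pt.2 :=
      hN'.comp c2
    refine (continuous_mk c1 (continuous_of_add h1 h2 continuous_val)).prodMk
      (continuous_mk c2 (continuous_of_add h2 h1 ?_))
    exact continuous_val.congr fun x => add_comm _ _

end Gr

/-- Square-summable rational sequences with the topology of pointwise convergence. -/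
def RatSq : Type := {x : ℕ → ℚ // Summable fun n => (x n : ℝ) ^ 2}

instance : TopologicalSpace RatSq := instTopologicalSpaceSubtype

/-- The square of the `ℓ²` norm. -/
def RatSq.sq (x : RatSq) : ℝ := ∑' n, (x.1 n : ℝ) ^ 2

namespace ErdosSpace

/-- The rational coordinates of a point. -/
def coord (x : ErdosSpace) (n : ℕ) : ℚ := (x.2 n).choose

theorem coe_coord (x : ErdosSpace) (n : ℕ) : (x.coord n : ℝ) = x.1 n := (x.2 n).choose_spec.symm

theorem hasSum_sq (x : lp (fun _ : ℕ => ℝ) 2) : HasSum (fun n => x n ^ 2) (‖x‖ ^ 2) := by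
  have h := lp.hasSum_norm (p := 2) (by norm_num) x
  simpa using h

theorem hasSum_coord (x : ErdosSpace) : HasSum (fun n => (x.coord n : ℝ) ^ 2) (‖x.1‖ ^ 2) := by
  simp_rw [coe_coord]
  exact hasSum_sq x.1

theorem continuous_val : Continuous fun x : ErdosSpace => x.1 := continuous_subtype_val

theorem continuous_coord (n : ℕ) : Continuous fun x : ErdosSpace => x.coord n := by
  rw [Rat.isEmbedding_coe_real.continuous_iff]
  have : Continuous fun x : ErdosSpace => x.1 n :=
    (lp.evalCLM ℝ (fun _ : ℕ => ℝ) 2 n).continuous.comp continuous_val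
  exact this.congr fun x => (coe_coord x n).symm

/-- The point of Erdős space with given coordinates. -/
def ofRat (x : RatSq) : ErdosSpace :=
  ⟨⟨fun n => (x.1 n : ℝ), by
    apply memℓp_gen
    refine x.2.congr fun n => ?_
    rw [Real.norm_eq_abs]
    simp⟩, fun n => ⟨x.1 n, rfl⟩⟩

theorem ofRat_apply (x : RatSq) (n : ℕ) : (ofRat x).1 n = x.1 n := rfl

theorem coord_ofRat (x : RatSq) (n : ℕ) : (ofRat x).coord n = x.1 n := by
  have := coe_coord (ofRat x) n
  rw [ofRat_apply] at this
  exact_mod_cast this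

/-- The norm topology is determined by coordinates and the norm. -/
theorem tendsto_lp_of {T : Type*} [TopologicalSpace T] {f : T → lp (fun _ : ℕ => ℝ) 2}
    (hc : ∀ n, Continuous fun t => f t n) (hn : Continuous fun t => ‖f t‖ ^ 2) :
    Continuous f := by
  have hdist : ∀ (s : Finset ℕ) (v : ℕ → ℝ),
      Continuous fun t => ‖f t - ∑ i ∈ s, lp.single 2 i (v i)‖ := by
    intro s v
    have : ∀ t, ‖f t - ∑ i ∈ s, lp.single 2 i (v i)‖ =
        √(‖f t‖ ^ 2 - 2 * ∑ i ∈ s, f t i * v i +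
          ‖∑ i ∈ s, (lp.single 2 i (v i) : lp (fun _ : ℕ => ℝ) 2)‖ ^ 2) := by
      intro t
      rw [← Real.sqrt_sq (norm_nonneg _), norm_sub_sq_real, inner_sum]
      simp_rw [lp.inner_single_right]
      simp [mul_comm]
    simp_rw [this]
    refine Real.continuous_sqrt.comp ((hn.sub (continuous_const.mul ?_)).add continuous_const)
    exact continuous_finsetSum _ fun i _ => (hc i).mul continuous_const
  rw [continuous_iff_continuousAt]
  intro t
  rw [Metric.continuousAt_iff']
  intro ε hε
  have hs := lp.hasSum_single (p := 2) (by norm_num) (f t)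
  obtain ⟨s, hs⟩ := ((Metric.tendsto_nhds.1 hs) (ε / 2) (half_pos hε)).exists
  rw [dist_comm, dist_eq_norm] at hs
  filter_upwards [((hdist s (f t)).tendsto t).eventually_lt_const hs] with x hx
  calc dist (f x) (f t) ≤ dist (f x) (∑ i ∈ s, lp.single 2 i (f t i)) +
      dist (f t) (∑ i ∈ s, lp.single 2 i (f t i)) := dist_triangle_right _ _ _
    _ < ε / 2 + ε / 2 := by
      rw [dist_eq_norm, dist_eq_norm]
      exact add_lt_add hx hs
    _ = ε := by ring

/-- Erdős space as the graph of the norm. -/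
def homeoRat : ErdosSpace ≃ₜ Gr RatSq.sq where
  toFun x := ⟨⟨x.coord, x.hasSum_coord.summable⟩⟩
  invFun x := ofRat x.pt
  left_inv x := by
    apply Subtype.ext
    apply lp.ext
    funext n
    exact coe_coord x n
  right_inv x := by
    apply Gr.ext
    apply Subtype.ext
    funext n
    exact coord_ofRat x.pt n
  continuous_toFun := Gr.continuous_mk
    (Continuous.subtype_mk (continuous_pi fun n => continuous_coord n) _) (by
      have : Continuous fun x : ErdosSpace => ‖x.1‖ ^ 2 := continuous_val.norm.pow 2
      exact this.congr fun x => x.hasSum_coord.tsum_eq.symm)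
  continuous_invFun := by
    have h : Continuous fun x : Gr RatSq.sq => (ofRat x.pt).1 := by
      apply tendsto_lp_of
      · intro n
        simp_rw [ofRat_apply]
        exact Rat.continuous_coe_real.comp ((continuous_apply n).comp
          (continuous_subtype_val.comp Gr.continuous_pt))
      · refine Gr.continuous_val.congr fun x => ?_
        rw [← (hasSum_sq _).tsum_eq]
        rfl
    exact Continuous.subtype_mk h _

end ErdosSpace

theorem eventually_floor_eq {T : Type*} [TopologicalSpace T] {f : T → ℝ} {t : T}
    (hf : ContinuousAt f t) (ht : ∀ m : ℤ, f t ≠ m) : ∀ᶠ x in 𝓝 t, ⌊f x⌋ = ⌊f t⌋ := by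
  have h : ∀ᶠ x in 𝓝 t, f x ∈ Ioo (⌊f t⌋ : ℝ) (⌊f t⌋ + 1) :=
    hf.eventually (Ioo_mem_nhds (lt_of_le_of_ne (Int.floor_le _) (ht _).symm)
      (Int.lt_floor_add_one _))
  filter_upwards [h] with x hx
  rw [Int.floor_eq_iff]
  exact ⟨hx.1.le, hx.2⟩

theorem IsCode.of_family {A D : Type*} [TopologicalSpace A] {f : ℕ → A → D}
    (hloc : ∀ i a, ∀ᶠ x in 𝓝 a, f i x = f i a)
    (hbasis : ∀ a, ∀ U ∈ 𝓝 a, ∃ n, ∀ x, (∀ i < n, f i x = f i a) → x ∈ U) :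
    IsCode (fun n x i => if i < n then some (f i x) else none) where
  refine_succ n x y hxy := by
    funext k
    by_cases hk : k < n
    · simpa [hk, Nat.lt_succ_of_lt hk] using congrFun hxy k
    · simp [hk]
  basis a := by
    refine ⟨fun U => ⟨fun hU => ?_, ?_⟩⟩
    · obtain ⟨n, hn⟩ := hbasis a U hU
      refine ⟨n, trivial, fun x hx => hn x fun i hi => ?_⟩
      simpa [hi] using congrFun hx i
    · rintro ⟨n, -, hn⟩
      have : ∀ᶠ x in 𝓝 a, ∀ k ∈ Finset.range n, f k x = f k a := by
        rw [Filter.eventually_all_finset]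
        exact fun k _ => hloc k a
      filter_upwards [this] with x hx
      apply hn
      funext k
      by_cases hk : k < n
      · simp [hk, hx k (Finset.mem_range.2 hk)]
      · simp [hk]

/-- Dyadic approximations from cut points that are never rational. -/
def ratCell (i : ℕ) (q : ℚ) : ℤ := ⌊((q : ℝ) + √2) * 2 ^ i⌋

theorem eventually_ratCell (i : ℕ) (q : ℚ) : ∀ᶠ x in 𝓝 q, ratCell i x = ratCell i q := by
  refine eventually_floor_eq (f := fun x : ℚ => ((x : ℝ) + √2) * 2 ^ i)
    ((Rat.continuous_coe_real.add continuous_const).mul continuous_const).continuousAt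
    fun m hm => ?_
  apply (irrational_sqrt_two.ratCast_add q).mul_natCast (m := 2 ^ i) (by positivity)
  exact ⟨m, by push_cast; exact hm.symm⟩

theorem abs_sub_lt_of_ratCell_eq {i : ℕ} {x y : ℚ} (h : ratCell i x = ratCell i y) :
    |(x : ℝ) - y| < (1 / 2) ^ i := by
  have h1 := Int.abs_sub_lt_one_of_floor_eq_floor h
  have h2 : ((x : ℝ) + √2) * 2 ^ i - (y + √2) * 2 ^ i = (x - y) * 2 ^ i := by ring
  rw [h2, abs_mul, abs_of_pos (by positivity : (0 : ℝ) < 2 ^ i)] at h1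
  rw [one_div, inv_pow, ← one_div, lt_div_iff₀ (by positivity)]
  exact h1

theorem exists_ratCell_subset {q : ℚ} {U : Set ℚ} (hU : U ∈ 𝓝 q) :
    ∃ i, ∀ x, ratCell i x = ratCell i q → x ∈ U := by
  obtain ⟨ε, hε, h⟩ := Metric.mem_nhds_iff.1 hU
  obtain ⟨i, hi⟩ := exists_pow_lt_of_lt_one hε (by norm_num : (1 / 2 : ℝ) < 1)
  refine ⟨i, fun x hx => h ?_⟩
  rw [Metric.mem_ball, Rat.dist_eq]
  exact (abs_sub_lt_of_ratCell_eq hx).trans hi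

theorem isCode_ratCell :
    IsCode (fun n (q : ℚ) i => if i < n then some (ratCell i q) else none) := by
  refine IsCode.of_family eventually_ratCell fun a U hU => ?_
  obtain ⟨i, hi⟩ := exists_ratCell_subset hU
  exact ⟨i + 1, fun x hx => hi x (hx i (Nat.lt_succ_self i))⟩

/-- The square of a rational number, rounded at scale `2⁻ⁿ`. -/
def sqLevel (n : ℕ) (q : ℚ) : ℕ := ⌊2 ^ n * (q : ℝ) ^ 2 + (√2 - 1)⌋₊

theorem sqrt_two_bounds : 1 < √2 ∧ √2 < 2 := by
  constructor
  · exact Real.lt_sqrt_of_sq_lt (by norm_num)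
  · rw [Real.sqrt_lt' (by norm_num)]
    norm_num

theorem abs_sqLevel_sub (n : ℕ) (q : ℚ) :
    |(sqLevel n q : ℝ) * (1 / 2) ^ n - (q : ℝ) ^ 2| ≤ (1 / 2) ^ n := by
  obtain ⟨h1, h2⟩ := sqrt_two_bounds
  have h3 : (sqLevel n q : ℝ) ≤ 2 ^ n * (q : ℝ) ^ 2 + (√2 - 1) :=
    Nat.floor_le (by have := sq_nonneg (q : ℝ); positivity [h1, this])
  have h4 : 2 ^ n * (q : ℝ) ^ 2 + (√2 - 1) < sqLevel n q + 1 := Nat.lt_floor_add_one _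
  have h5 : (q : ℝ) ^ 2 = (2 ^ n * (q : ℝ) ^ 2) * (1 / 2) ^ n := by
    rw [one_div, inv_pow]; field_simp
  rw [h5, ← sub_mul, abs_mul, abs_of_pos (by positivity : (0 : ℝ) < (1 / 2) ^ n)]
  refine mul_le_of_le_one_left (by positivity) ?_
  rw [abs_le]
  constructor <;> linarith

theorem eventually_sqLevel (n : ℕ) (q : ℚ) : ∀ᶠ x in 𝓝 q, sqLevel n x = sqLevel n q := by
  have : ∀ᶠ x : ℚ in 𝓝 q, ⌊2 ^ n * (x : ℝ) ^ 2 + (√2 - 1)⌋ = ⌊2 ^ n * (q : ℝ) ^ 2 + (√2 - 1)⌋ := by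
    refine eventually_floor_eq (f := fun x : ℚ => 2 ^ n * (x : ℝ) ^ 2 + (√2 - 1))
      ((continuous_const.mul (Rat.continuous_coe_real.pow 2)).add continuous_const).continuousAt
      fun m hm => ?_
    apply irrational_sqrt_two
    refine ⟨m + 1 - 2 ^ n * q ^ 2, ?_⟩
    push_cast
    linarith
  filter_upwards [this] with x hx
  rw [sqLevel, sqLevel, ← Int.floor_toNat, ← Int.floor_toNat, hx]

theorem sqLevel_surjective (n : ℕ) : Function.Surjective (sqLevel n) := by
  intro l
  obtain ⟨h1, h2⟩ := sqrt_two_bounds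
  have hc : Continuous fun x : ℝ => 2 ^ n * x ^ 2 + (√2 - 1) := by fun_prop
  have hU : IsOpen ((fun x : ℝ => 2 ^ n * x ^ 2 + (√2 - 1)) ⁻¹' Ioo (l : ℝ) (l + 1)) :=
    isOpen_Ioo.preimage hc
  obtain ⟨q, hq⟩ := Rat.denseRange_cast (𝕜 := ℝ) |>.exists_mem_open hU ⟨√(l / 2 ^ n), by
    rw [mem_preimage, Real.sq_sqrt (by positivity), mul_div_cancel₀ _ (by positivity)]
    constructor <;> linarith⟩
  exact ⟨q, (Nat.floor_eq_iff (by have := hq.1; exact (Nat.cast_nonneg l).trans this.le)).2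
    ⟨hq.1.le, hq.2⟩⟩

theorem exists_homeomorph_sqLevel (n : ℕ) :
    ∃ φ : ℚ ≃ₜ ℕ × BinFin, ∀ q, (φ q).1 = sqLevel n q := by
  refine exists_fiber_homeomorph_of_countable isCode_ratCell (IsCode.of_discrete ℕ) ?_ ?_
    (sqLevel_surjective n) ?_
  · rw [continuous_iff_continuousAt]
    intro q
    exact continuousAt_const.congr ((eventually_sqLevel n q).mono fun x hx => hx.symm)
  · exact fun U _ => isOpen_discrete _
  · intro q O hO
    have h := Filter.inter_mem hO (eventually_sqLevel n q)
    obtain ⟨x, hx, hne⟩ := Filter.nonempty_of_mem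
      (Filter.inter_mem (mem_nhdsWithin_of_mem_nhds h) (self_mem_nhdsWithin (s := {q}ᶜ)))
    exact ⟨x, hx.1, hne, hx.2⟩

/-- Sequences of labelled heights whose weighted sum converges. -/
def Ladder : Type := {x : ℕ → ℕ × BinFin // Summable fun n => ((x n).1 : ℝ) * (1 / 2) ^ n}

instance : TopologicalSpace Ladder := instTopologicalSpaceSubtype

/-- The weighted sum of the heights. -/
def Ladder.weight (x : Ladder) : ℝ := ∑' n, ((x.1 n).1 : ℝ) * (1 / 2) ^ n

theorem exists_homeomorph_ladder : Nonempty (ErdosSpace ≃ₜ Gr Ladder.weight) := by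
  choose φ hφ using exists_homeomorph_sqLevel
  have hgeo : Summable fun n : ℕ => (1 / 2 : ℝ) ^ n := summable_geometric_two
  have hdiff : ∀ x : ℕ → ℚ,
      Summable fun n => (sqLevel n (x n) : ℝ) * (1 / 2) ^ n - (x n : ℝ) ^ 2 := fun x =>
    Summable.of_norm_bounded hgeo fun n => abs_sqLevel_sub n (x n)
  have hto : ∀ x : RatSq, Summable fun n => ((φ n (x.1 n)).1 : ℝ) * (1 / 2) ^ n := by
    intro x
    refine ((hdiff x.1).add x.2).congr fun n => ?_
    rw [hφ]
    ring
  have hinv : ∀ x : Ladder, Summable fun n => (((φ n).symm (x.1 n) : ℚ) : ℝ) ^ 2 := by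
    intro x
    refine (x.2.sub (hdiff fun n => (φ n).symm (x.1 n))).congr fun n => ?_
    rw [← hφ, (φ n).apply_symm_apply]
    ring
  let Φ : RatSq ≃ₜ Ladder :=
    { toFun := fun x => ⟨fun n => φ n (x.1 n), hto x⟩
      invFun := fun x => ⟨fun n => (φ n).symm (x.1 n), hinv x⟩
      left_inv := fun x => Subtype.ext (funext fun n => (φ n).symm_apply_apply _)
      right_inv := fun x => Subtype.ext (funext fun n => (φ n).apply_symm_apply _)
      continuous_toFun := Continuous.subtype_mk (continuous_pi fun n =>
        (φ n).continuous.comp ((continuous_apply n).comp continuous_subtype_val)) _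
      continuous_invFun := Continuous.subtype_mk (continuous_pi fun n =>
        (φ n).symm.continuous.comp ((continuous_apply n).comp continuous_subtype_val)) _ }
  refine ⟨ErdosSpace.homeoRat.trans (Gr.congr Φ ?_)⟩
  have hc : Continuous fun x : RatSq =>
      ∑' n, ((sqLevel n (x.1 n) : ℝ) * (1 / 2) ^ n - (x.1 n : ℝ) ^ 2) := by
    refine continuous_tsum (fun n => ?_) hgeo fun n x => abs_sqLevel_sub n (x.1 n)
    have h1 : Continuous fun x : RatSq => x.1 n :=
      (continuous_apply n).comp continuous_subtype_val
    have h2 : Continuous fun q : ℚ => (sqLevel n q : ℝ) := by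
      rw [continuous_iff_continuousAt]
      intro q
      exact continuousAt_const.congr
        ((eventually_sqLevel n q).mono fun x hx => congrArg Nat.cast hx.symm)
    exact ((h2.comp h1).mul continuous_const).sub ((Rat.continuous_coe_real.comp h1).pow 2)
  refine hc.congr fun x => ?_
  have h1 : Ladder.weight (Φ x) = ∑' n, (sqLevel n (x.1 n) : ℝ) * (1 / 2) ^ n :=
    tsum_congr fun n => by rw [← hφ]; rfl
  have h2 : Summable fun n => (sqLevel n (x.1 n) : ℝ) * (1 / 2) ^ n :=
    (hto x).congr fun n => by rw [hφ]
  rw [h1, RatSq.sq, h2.tsum_sub x.2]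

open Filter

/-- A stratification of a set: a refining separating sequence of partitions into countably many
pieces, a function that is lower semicontinuous for the topology of the partitions, and countably
many exhaustions that are jointly complete. -/
structure Strat (Y : Type*) where
  /-- the partitions -/
  c : ℕ → Y → ℕ
  /-- the height function -/
  η : Y → ℝ
  /-- the exhaustions -/
  K : ℕ → ℕ → Set Y
  refine_succ : ∀ n x y, c (n + 1) x = c (n + 1) y → c n x = c n y
  c_zero : ∀ x y, c 0 x = c 0 y
  sep : ∀ x y, (∀ n, c n x = c n y) → x = y
  nonneg : ∀ y, 0 ≤ η y
  lsc : ∀ y, ∀ ε > 0, ∃ n, ∀ y', c n y' = c n y → η y - ε < η y'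
  K_mono : ∀ k, Monotone (K k)
  K_cover : ∀ k y, ∃ j, y ∈ K k j
  complete : ∀ (j z : ℕ → ℕ), (∀ k m, ∃ y ∈ K k (j k), ∀ l ≤ m, c l y = z l) →
    ∃ y, (∀ l, c l y = z l) ∧ ∀ k, y ∈ K k (j k)

namespace Strat

variable {Y : Type*} (S : Strat Y)

theorem c_mono {m n : ℕ} (hmn : m ≤ n) {x y : Y} (h : S.c n x = S.c n y) : S.c m x = S.c m y := by
  induction hmn with
  | refl => exact h
  | step _ ih => exact ih (S.refine_succ _ _ _ h)

theorem exists_pick (n : ℕ) (y : Y) :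
    ∃ x, S.c n x = S.c n y ∧ ∀ y', S.c n y' = S.c n y → S.η x ≤ S.η y' + (1 / 2) ^ n := by
  have hne : (S.η '' {x | S.c n x = S.c n y}).Nonempty := ⟨_, y, rfl, rfl⟩
  have hbdd : BddBelow (S.η '' {x | S.c n x = S.c n y}) := ⟨0, by
    rintro _ ⟨x, -, rfl⟩
    exact S.nonneg x⟩
  obtain ⟨_, ⟨x, hx, rfl⟩, hlt⟩ := exists_lt_of_csInf_lt hne
    (lt_add_of_pos_right (sInf (S.η '' {x | S.c n x = S.c n y}))
      (by positivity : (0 : ℝ) < (1 / 2) ^ n))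
  refine ⟨x, hx, fun y' hy' => hlt.le.trans ?_⟩
  have := csInf_le hbdd ⟨y', hy', rfl⟩
  linarith

theorem exists_pick_fun [Nonempty Y] : ∃ pick : ℕ → ℕ → Y, ∀ n y,
    S.c n (pick n (S.c n y)) = S.c n y ∧
      ∀ y', S.c n y' = S.c n y → S.η (pick n (S.c n y)) ≤ S.η y' + (1 / 2) ^ n := by
  have h : ∀ n d, ∃ x, ∀ y, S.c n y = d → S.c n x = S.c n y ∧
      ∀ y', S.c n y' = S.c n y → S.η x ≤ S.η y' + (1 / 2) ^ n := by
    intro n d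
    by_cases hd : ∃ y, S.c n y = d
    · obtain ⟨y, rfl⟩ := hd
      obtain ⟨x, hx⟩ := S.exists_pick n y
      refine ⟨x, fun y' hy' => ?_⟩
      rw [hy']
      exact hx
    · exact ⟨Classical.arbitrary Y, fun y hy => (hd ⟨y, hy⟩).elim⟩
  choose pick hpick using h
  exact ⟨pick, fun n y => hpick n _ y rfl⟩

/-- The infimum of the height on the piece of `y`. -/
def low (n : ℕ) (y : Y) : ℝ := sInf (S.η '' {x | S.c n x = S.c n y})

theorem low_le {n : ℕ} {x y : Y} (h : S.c n x = S.c n y) : S.low n y ≤ S.η x :=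
  csInf_le ⟨0, by rintro _ ⟨x, -, rfl⟩; exact S.nonneg x⟩ ⟨x, h, rfl⟩

theorem le_low {n : ℕ} {y : Y} {a : ℝ} (h : ∀ x, S.c n x = S.c n y → a ≤ S.η x) :
    a ≤ S.low n y :=
  le_csInf ⟨_, y, rfl, rfl⟩ (by rintro _ ⟨x, hx, rfl⟩; exact h x hx)

theorem low_succ (n : ℕ) (y : Y) : S.low n y ≤ S.low (n + 1) y :=
  S.le_low fun _ hx => S.low_le (S.refine_succ _ _ _ hx)

variable [Nonempty Y]

/-- Near-minimisers of the height on each piece. -/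
def pick : ℕ → ℕ → Y := S.exists_pick_fun.choose

theorem c_pick (n : ℕ) (y : Y) : S.c n (S.pick n (S.c n y)) = S.c n y :=
  (S.exists_pick_fun.choose_spec n y).1

theorem η_pick {n : ℕ} {y y' : Y} (h : S.c n y' = S.c n y) :
    S.η (S.pick n (S.c n y)) ≤ S.η y' + (1 / 2) ^ n :=
  (S.exists_pick_fun.choose_spec n y).2 y' h

/-- Commuting retractions onto representatives of the pieces. -/
def r : ℕ → Y → Y
  | 0, y => S.pick 0 (S.c 0 y)
  | n + 1, y => if S.c (n + 1) (r n y) = S.c (n + 1) y then r n y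
    else S.pick (n + 1) (S.c (n + 1) y)

theorem r_succ_of_eq {n : ℕ} {y : Y} (h : S.c (n + 1) (S.r n y) = S.c (n + 1) y) :
    S.r (n + 1) y = S.r n y := if_pos h

theorem r_succ_of_ne {n : ℕ} {y : Y} (h : S.c (n + 1) (S.r n y) ≠ S.c (n + 1) y) :
    S.r (n + 1) y = S.pick (n + 1) (S.c (n + 1) y) := if_neg h

theorem c_r (n : ℕ) (y : Y) : S.c n (S.r n y) = S.c n y := by
  cases n with
  | zero => exact S.c_zero _ _
  | succ n =>
    by_cases h : S.c (n + 1) (S.r n y) = S.c (n + 1) y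
    · rw [S.r_succ_of_eq h, h]
    · rw [S.r_succ_of_ne h, S.c_pick]

theorem r_congr {n : ℕ} {x y : Y} (h : S.c n x = S.c n y) : S.r n x = S.r n y := by
  induction n with
  | zero => rw [r, r, h]
  | succ n ih => rw [r, r, ih (S.refine_succ _ _ _ h), h]

theorem r_r_of_le {m n : ℕ} (h : m ≤ n) (y : Y) : S.r m (S.r n y) = S.r m y :=
  S.r_congr (S.c_mono h (S.c_r n y))

theorem r_fix_of_le {m n : ℕ} (h : n ≤ m) {x : Y} (hx : S.r n x = x) : S.r m x = x := by
  induction h with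
  | refl => exact hx
  | step _ ih => rw [Nat.succ_eq_add_one, S.r_succ_of_eq (by rw [ih]), ih]

theorem r_r_of_ge {m n : ℕ} (h : n ≤ m) (y : Y) : S.r m (S.r n y) = S.r n y :=
  S.r_fix_of_le h (S.r_r_of_le le_rfl y)

theorem r_zero (x y : Y) : S.r 0 x = S.r 0 y := S.r_congr (S.c_zero x y)

theorem eq_of_forall_r {x y : Y} (h : ∀ n, S.r n x = S.r n y) : x = y :=
  S.sep x y fun n => by rw [← S.c_r n x, h n, S.c_r]

theorem countable_fixed (n : ℕ) : {x | S.r n x = x}.Countable := by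
  have : InjOn (S.c n) {x | S.r n x = x} := by
    intro x hx y hy h
    rw [← (hx : S.r n x = x), ← (hy : S.r n y = y), S.r_congr h]
  exact MapsTo.countable_of_injOn (mapsTo_univ _ _) this countable_univ

theorem tendsto_η_r (y : Y) : Tendsto (fun n => S.η (S.r n y)) atTop (𝓝 (S.η y)) := by
  rw [tendsto_order]
  constructor
  · intro a ha
    obtain ⟨n, hn⟩ := S.lsc y (S.η y - a) (by linarith)
    filter_upwards [eventually_ge_atTop n] with m hm
    have := hn (S.r m y) (S.c_mono hm (S.c_r m y))
    linarith
  · intro a ha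
    obtain ⟨k, hk⟩ := exists_pow_lt_of_lt_one (sub_pos.2 ha) (by norm_num : (1 / 2 : ℝ) < 1)
    have hpow : ∀ n ≥ k, (1 / 2 : ℝ) ^ n < a - S.η y := fun n hn =>
      (pow_le_pow_of_le_one (by norm_num) (by norm_num) hn).trans_lt hk
    by_cases hch : ∃ n ≥ k, S.c (n + 1) (S.r n y) ≠ S.c (n + 1) y
    · obtain ⟨n, hn, hne⟩ := hch
      filter_upwards [eventually_ge_atTop (n + 1)] with m hm
      induction m, hm using Nat.le_induction with
      | base =>
        rw [S.r_succ_of_ne hne]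
        have := S.η_pick (n := n + 1) (y := y) rfl
        have := hpow (n + 1) (by omega)
        linarith
      | succ m hm ih =>
        by_cases h : S.c (m + 1) (S.r m y) = S.c (m + 1) y
        · rwa [S.r_succ_of_eq h]
        · rw [S.r_succ_of_ne h]
          have := S.η_pick (n := m + 1) (y := y) rfl
          have := hpow (m + 1) (by omega)
          linarith
    · push Not at hch
      have hconst : ∀ m ≥ k, S.r m y = S.r k y := by
        intro m hm
        induction m, hm using Nat.le_induction with
        | base => rfl
        | succ m hm ih => rw [S.r_succ_of_eq (hch m hm), ih]
      have hy : S.r k y = y := by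
        apply S.eq_of_forall_r
        intro n
        rcases le_total n k with h | h
        · exact S.r_r_of_le h y
        · rw [S.r_r_of_ge h, hconst n h]
      filter_upwards [eventually_ge_atTop k] with m hm
      rwa [hconst m hm, hy]

/-- The excess of the representative over the infimum. -/
def exc (n : ℕ) (y : Y) : ℝ := S.η (S.r n y) - S.low n y

theorem exc_nonneg (n : ℕ) (y : Y) : 0 ≤ S.exc n y := sub_nonneg.2 (S.low_le (S.c_r n y))

theorem exc_congr {n : ℕ} {x y : Y} (h : S.c n x = S.c n y) : S.exc n x = S.exc n y := by
  rw [exc, exc, S.r_congr h, low, low, h]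

theorem tendsto_exc (y : Y) : Tendsto (fun n => S.exc n y) atTop (𝓝 0) := by
  have h : Tendsto (fun n => S.low n y) atTop (𝓝 (S.η y)) := by
    rw [tendsto_order]
    refine ⟨fun a ha => ?_, fun a ha => Eventually.of_forall fun n => (S.low_le rfl).trans_lt ha⟩
    obtain ⟨n, hn⟩ := S.lsc y ((S.η y - a) / 2) (by linarith)
    filter_upwards [eventually_ge_atTop n] with m hm
    have : S.η y - (S.η y - a) / 2 ≤ S.low m y := S.le_low fun x hx => (hn x (S.c_mono hm hx)).le
    linarith
  simpa [exc] using (S.tendsto_η_r y).sub h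

/-- The decrease of the height from one representative to the next. -/
def dec (n : ℕ) (y : Y) : ℝ := max 0 (S.η (S.r n y) - S.η (S.r (n + 1) y))

/-- The increase of the height from one representative to the next. -/
def inc (n : ℕ) (y : Y) : ℝ := max 0 (S.η (S.r (n + 1) y) - S.η (S.r n y))

theorem dec_nonneg (n : ℕ) (y : Y) : 0 ≤ S.dec n y := le_max_left _ _

theorem inc_nonneg (n : ℕ) (y : Y) : 0 ≤ S.inc n y := le_max_left _ _

theorem inc_sub_dec (n : ℕ) (y : Y) :
    S.inc n y - S.dec n y = S.η (S.r (n + 1) y) - S.η (S.r n y) := by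
  rw [inc, dec]
  rcases le_total (S.η (S.r (n + 1) y)) (S.η (S.r n y)) with h | h
  · rw [max_eq_left (by linarith), max_eq_right (by linarith)]
    ring
  · rw [max_eq_right (by linarith), max_eq_left (by linarith)]
    ring

theorem dec_congr {n m : ℕ} (h : n < m) {x y : Y} (hxy : S.c m x = S.c m y) :
    S.dec n x = S.dec n y := by
  rw [dec, dec, S.r_congr (S.c_mono h hxy), S.r_congr (S.c_mono h.le hxy)]

theorem dec_le (n : ℕ) (y : Y) :
    S.dec n y ≤ S.exc n y - S.exc (n + 1) y + (1 / 2) ^ (n + 1) := by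
  have h1 := S.low_succ n y
  have h2 := S.exc_nonneg n y
  have h3 : (0 : ℝ) < (1 / 2) ^ (n + 1) := by positivity
  apply max_le
  · by_cases h : S.c (n + 1) (S.r n y) = S.c (n + 1) y
    · rw [exc, exc, S.r_succ_of_eq h]
      linarith
    · have : S.exc (n + 1) y ≤ (1 / 2) ^ (n + 1) := by
        rw [exc, S.r_succ_of_ne h, sub_le_comm]
        refine S.le_low fun x hx => ?_
        have := S.η_pick hx
        linarith
      linarith
  · rw [exc, exc]
    linarith

theorem sum_dec_le (m k : ℕ) (y : Y) :
    ∑ i ∈ Finset.range k, S.dec (i + m) y ≤ S.exc m y + (1 / 2) ^ m := by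
  have h : ∑ i ∈ Finset.range k, S.dec (i + m) y ≤
      S.exc m y - S.exc (k + m) y + ((1 / 2) ^ m - (1 / 2) ^ (k + m)) := by
    induction k with
    | zero => simp
    | succ k ih =>
      rw [Finset.sum_range_succ]
      have h1 := S.dec_le (k + m) y
      have h2 : (1 / 2 : ℝ) ^ (k + m) = 2 * (1 / 2) ^ (k + m + 1) := by ring
      have h3 : k + 1 + m = k + m + 1 := by ring
      rw [h3]
      linarith
  have h1 := S.exc_nonneg (k + m) y
  have h2 : (0 : ℝ) < (1 / 2) ^ (k + m) := by positivity
  linarith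

theorem summable_dec (y : Y) : Summable fun n => S.dec n y :=
  summable_of_sum_range_le (fun n => S.dec_nonneg n y) fun k => S.sum_dec_le 0 k y

/-- The total decrease of the height along the representatives. -/
def totalDec (y : Y) : ℝ := ∑' n, S.dec n y

theorem hasSum_inc (y : Y) :
    HasSum (fun n => S.inc n y) (S.η y - S.η (S.r 0 y) + S.totalDec y) := by
  rw [hasSum_iff_tendsto_nat_of_nonneg (fun n => S.inc_nonneg n y)]
  have h1 : ∀ n, ∑ i ∈ Finset.range n, S.inc i y =
      S.η (S.r n y) - S.η (S.r 0 y) + ∑ i ∈ Finset.range n, S.dec i y := by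
    intro n
    rw [← Finset.sum_range_sub (fun i => S.η (S.r i y)), ← Finset.sum_add_distrib]
    refine Finset.sum_congr rfl fun i _ => ?_
    rw [← inc_sub_dec]
    ring
  simp_rw [h1]
  exact ((S.tendsto_η_r y).sub_const _).add (S.summable_dec y).hasSum.tendsto_sum_nat

theorem totalDec_sub_le {m : ℕ} {x y : Y} (h : S.c m x = S.c m y) :
    |S.totalDec x - S.totalDec y| ≤ S.exc m y + (1 / 2) ^ m := by
  have hx := (S.summable_dec x).sum_add_tsum_nat_add m
  have hy := (S.summable_dec y).sum_add_tsum_nat_add m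
  have heq : ∑ i ∈ Finset.range m, S.dec i x = ∑ i ∈ Finset.range m, S.dec i y :=
    Finset.sum_congr rfl fun i hi => S.dec_congr (Finset.mem_range.1 hi) h
  have htail : ∀ z, 0 ≤ ∑' i, S.dec (i + m) z ∧ ∑' i, S.dec (i + m) z ≤ S.exc m z + (1 / 2) ^ m :=
    fun z => ⟨tsum_nonneg fun i => S.dec_nonneg _ _,
      Real.tsum_le_of_sum_range_le (fun i => S.dec_nonneg _ _) fun k => S.sum_dec_le m k z⟩
  have h1 := htail x
  have h2 := htail y
  rw [S.exc_congr h] at h1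
  rw [totalDec, totalDec, abs_le]
  constructor <;> linarith

/-- The exhaustions, saturated under the retractions. -/
def Kp (k j : ℕ) : Set Y := {y | y ∈ S.K k j ∨ ∃ n, ∃ y' ∈ S.K k j, S.r n y' = y}

theorem Kp_mono (k : ℕ) : Monotone (S.Kp k) := by
  rintro i j hij y (h | ⟨n, y', hy', rfl⟩)
  · exact Or.inl (S.K_mono k hij h)
  · exact Or.inr ⟨n, y', S.K_mono k hij hy', rfl⟩

theorem Kp_cover (k : ℕ) (y : Y) : ∃ j, y ∈ S.Kp k j := by
  obtain ⟨j, hj⟩ := S.K_cover k y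
  exact ⟨j, Or.inl hj⟩

theorem r_mem_Kp {k j : ℕ} {y : Y} (h : y ∈ S.Kp k j) (m : ℕ) : S.r m y ∈ S.Kp k j := by
  rcases h with h | ⟨n, y', hy', rfl⟩
  · exact Or.inr ⟨m, y, h, rfl⟩
  · rcases le_total m n with hmn | hmn
    · rw [S.r_r_of_le hmn]
      exact Or.inr ⟨m, y', hy', rfl⟩
    · rw [S.r_r_of_ge hmn]
      exact Or.inr ⟨n, y', hy', rfl⟩

theorem exists_limit {x : ℕ → Y} (hx : ∀ n, S.r n (x (n + 1)) = x n) {j : ℕ → ℕ}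
    (hK : ∀ k m, k < m → x m ∈ S.Kp k (j k)) :
    ∃ y, (∀ n, S.r n y = x n) ∧ ∀ k, y ∈ S.Kp k (j k) := by
  have hself : ∀ n, S.r n (x n) = x n := fun n => by
    rw [← hx n, S.r_r_of_le le_rfl]
  have hcoh : ∀ n m, n ≤ m → S.r n (x m) = x n := by
    intro n m hnm
    induction hnm with
    | refl => exact hself n
    | @step m h ih => exact (S.r_r_of_le h (x (m + 1))).symm.trans (by rw [hx]; exact ih)
  have hcc : ∀ n m, n ≤ m → S.c n (x m) = S.c n (x n) := fun n m hnm => by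
    rw [← S.c_r n (x m), hcoh n m hnm]
  by_cases hconst : ∃ M, ∀ m ≥ M, x m = x M
  · obtain ⟨M, hM⟩ := hconst
    refine ⟨x M, fun n => ?_, fun k => ?_⟩
    · rcases le_total n M with h | h
      · exact hcoh n M h
      · rw [← hM (n + 1) (by omega), hx]
    · rw [← hM (max M (k + 1)) (le_max_left _ _)]
      exact hK k _ (lt_of_lt_of_le (Nat.lt_succ_self k) (le_max_right _ _))
  · obtain ⟨y, hy, hyK⟩ := S.complete j (fun l => S.c l (x l)) (by
      intro k m
      by_contra hcon
      push Not at hcon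
      have hall : ∀ m' ≥ max m (k + 1), x m' = x m := by
        intro m' hm'
        have hm : m ≤ m' := (le_max_left _ _).trans hm'
        have hk : k < m' := lt_of_lt_of_le (Nat.lt_succ_self k) ((le_max_right _ _).trans hm')
        rcases hK k m' hk with h | ⟨n, y', hy', hr⟩
        · obtain ⟨l, hl, hne⟩ := hcon _ h
          exact (hne (hcc l m' (hl.trans hm))).elim
        · rcases le_total m n with hmn | hmn
          · obtain ⟨l, hl, hne⟩ := hcon _ hy'
            refine (hne ?_).elim
            rw [← hcc l m' (hl.trans hm), ← hr, S.c_mono (hl.trans hmn) (S.c_r n y')]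
          · rw [← hcoh m m' hm, ← hr, S.r_r_of_ge hmn]
      exact hconst ⟨max m (k + 1), fun m' hm' => by rw [hall m' hm', hall _ le_rfl]⟩)
    refine ⟨y, fun n => ?_, fun k => Or.inl (hyK k)⟩
    rw [← hself n]
    exact S.r_congr (hy n)

theorem mem_Kp_of_forall {k j : ℕ} {y : Y} (h : ∀ n, ∃ y' ∈ S.Kp k j, S.c n y' = S.c n y) :
    y ∈ S.Kp k j := by
  classical
  choose J hJ using fun k => S.Kp_cover k y
  obtain ⟨y', h1, h2⟩ := S.exists_limit (x := fun n => S.r n y) (j := Function.update J k j)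
    (fun n => S.r_r_of_le (Nat.le_succ n) y) (by
      intro k' m _
      by_cases hk : k' = k
      · subst hk
        rw [Function.update_self]
        obtain ⟨y', hy', hc⟩ := h m
        rw [← S.r_congr hc]
        exact S.r_mem_Kp hy' m
      · rw [Function.update_of_ne hk]
        exact S.r_mem_Kp (hJ k') m)
  rw [S.eq_of_forall_r h1] at h2
  simpa using h2 k

end Strat

namespace Strat

variable {Y : Type*} (S : Strat Y)

/-- The points of a stratified set, with the topology of the partitions. -/
@[ext]
structure Pt {Y : Type*} (S : Strat Y) where
  /-- The underlying point. -/
  pt : Y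

instance : TopologicalSpace S.Pt :=
  TopologicalSpace.induced (fun x n => S.c n x.pt) inferInstance

namespace Pt

theorem isInducing : IsInducing fun (x : S.Pt) n => S.c n x.pt := ⟨rfl⟩

theorem eventually_c (n : ℕ) (a : S.Pt) : ∀ᶠ x in 𝓝 a, S.c n x.pt = S.c n a.pt := by
  have h : Continuous fun x : S.Pt => S.c n x.pt :=
    (continuous_apply n).comp (isInducing S).continuous
  exact h.continuousAt.eventually_mem (mem_nhds_discrete.2 rfl : {S.c n a.pt} ∈ 𝓝 _)

theorem isCode : IsCode fun n (x : S.Pt) => S.c n x.pt where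
  refine_succ n x y h := S.refine_succ n _ _ h
  basis a := by
    refine ⟨fun U => ⟨fun hU => ?_, fun ⟨n, _, hn⟩ => mem_of_superset (eventually_c S n a) hn⟩⟩
    obtain ⟨n, -, hn⟩ := ((IsCode.of_discrete ℕ).pi.comp_isInducing (isInducing S)).exists_cone hU 0
    refine ⟨n, trivial, fun x hx => hn x ?_⟩
    funext k
    by_cases hk : k < n
    · simp [hk, S.c_mono hk.le hx]
    · simp [hk]

instance : T2Space S.Pt :=
  T2Space.of_injective_continuous (f := fun (x : S.Pt) n => S.c n x.pt)
    (fun _ _ h => Pt.ext (S.sep _ _ fun n => congrFun h n)) (isInducing S).continuous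

theorem lowerSemicontinuous_η : LowerSemicontinuous fun x : S.Pt => S.η x.pt := by
  intro x a ha
  obtain ⟨n, hn⟩ := S.lsc x.pt (S.η x.pt - a) (by linarith)
  filter_upwards [eventually_c S n x] with y hy
  have := hn y.pt hy
  linarith

/-- A space topologised by a stratification is a graph over the points of the stratification. -/
def homeomorph [TopologicalSpace Y] (h : IsInducing fun y => ((fun n => S.c n y), S.η y)) :
    Y ≃ₜ Gr (fun x : S.Pt => S.η x.pt) where
  toFun y := ⟨⟨y⟩⟩
  invFun x := x.pt.pt
  left_inv _ := rfl
  right_inv _ := rfl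
  continuous_toFun := Gr.continuous_mk
    ((isInducing S).continuous_iff.2 (continuous_fst.comp h.continuous))
    (continuous_snd.comp h.continuous)
  continuous_invFun := h.continuous_iff.2
    (((isInducing S).continuous.comp Gr.continuous_pt).prodMk Gr.continuous_val)

theorem isClosed_Kp [Nonempty Y] (k j : ℕ) : IsClosed {y : S.Pt | y.pt ∈ S.Kp k j} := by
  rw [isClosed_iff_frequently]
  intro y hy
  refine S.mem_Kp_of_forall fun n => ?_
  obtain ⟨y', h1, h2⟩ := (hy.and_eventually (eventually_c S n y)).exists
  exact ⟨y'.pt, h1, h2⟩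

theorem continuous_r [Nonempty Y] (n : ℕ) : Continuous fun x : S.Pt => (⟨S.r n x.pt⟩ : S.Pt) := by
  rw [continuous_iff_continuousAt]
  intro x
  refine (continuousAt_const (y := (⟨S.r n x.pt⟩ : S.Pt))).congr
    ((eventually_c S n x).mono fun y hy => ?_)
  exact Pt.ext (S.r_congr hy).symm

theorem continuous_totalDec [Nonempty Y] : Continuous fun x : S.Pt => S.totalDec x.pt := by
  rw [continuous_iff_continuousAt]
  intro x
  rw [ContinuousAt, Metric.tendsto_nhds]
  intro ε hε
  have h : Tendsto (fun m => S.exc m x.pt + (1 / 2) ^ m) atTop (𝓝 (0 + 0)) :=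
    (S.tendsto_exc x.pt).add (tendsto_pow_atTop_nhds_zero_of_lt_one (by norm_num) (by norm_num))
  rw [add_zero] at h
  obtain ⟨m, hm⟩ := (h.eventually (gt_mem_nhds hε)).exists
  filter_upwards [eventually_c S m x] with y hy
  rw [Real.dist_eq]
  exact (S.totalDec_sub_le hy).trans_lt hm

end Pt

variable [Nonempty Y]

/-- Labels allowed over a point by one exhaustion. -/
def Labels (k : ℕ) : Set (S.Pt × BinFin) := {a | a.1.pt ∈ S.Kp k (BinFin.idx a.2)}

theorem exists_labels_homeomorph (k : ℕ) :
    ∃ φ : S.Labels k ≃ₜ S.Pt × BinFin, ∀ a, (φ a).1 = a.1.1 := by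
  classical
  obtain ⟨e, he⟩ := exists_surjective_nat BinFin
  have hbase : ∀ y : S.Pt, ∃ t, (y, t) ∈ S.Labels k := fun y => by
    obtain ⟨j, hj⟩ := S.Kp_cover k y.pt
    obtain ⟨t, -, -, ht⟩ := BinFin.exists_ne_idx_ge default univ_mem j
    exact ⟨t, S.Kp_mono k ht hj⟩
  choose t₀ ht₀ using hbase
  let sec (t : BinFin) (y : S.Pt) : S.Labels k :=
    if h : (y, t) ∈ S.Labels k then ⟨(y, t), h⟩ else ⟨(y, t₀ y), ht₀ y⟩
  have hsec : ∀ t y, (y, t) ∈ S.Labels k → (sec t y : S.Pt × BinFin) = (y, t) := fun t y h => by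
    simp only [sec, dif_pos h]
  have hsecc : ∀ t, ContinuousOn (sec t) {y | (y, t) ∈ S.Labels k} := by
    intro t
    rw [IsInducing.subtypeVal.continuousOn_iff]
    refine ContinuousOn.congr (f := fun y => (y, t)) (by fun_prop) fun y hy => hsec t y hy
  have hfib : FiberData (fun n (a : S.Labels k) => _) (fun n (x : S.Pt) => S.c n x.pt)
      (fun a => a.1.1) (fun j => {y : S.Pt | y.pt ∈ S.Kp k j})
      (fun m => {y | (y, e m) ∈ S.Labels k}) (fun m => sec (e m)) :=
    { codeA := ((Pt.isCode S).prod BinFin.isCode).subtype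
      codeB := Pt.isCode S
      cont := by fun_prop
      isOpenMap := by
        refine IsOpenMap.of_nhds_le ?_
        rintro ⟨⟨y, t⟩, ha⟩ U hU
        rw [mem_map, nhds_subtype_eq_comap] at hU
        obtain ⟨V, hV, hVU⟩ := hU
        obtain ⟨V₁, hV₁, V₂, hV₂, hVV⟩ := mem_nhds_prod_iff.1 hV
        refine mem_of_superset hV₁ fun z hz => ?_
        obtain ⟨j, hj⟩ := S.Kp_cover k z.pt
        obtain ⟨t', h1, -, h3⟩ := BinFin.exists_ne_idx_ge t hV₂ j
        have hmem : (z, t') ∈ S.Labels k := S.Kp_mono k h3 hj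
        exact hVU (show (⟨(z, t'), hmem⟩ : S.Labels k) ∈ Subtype.val ⁻¹' V from hVV ⟨hz, h1⟩)
      surj := fun y => ⟨⟨(y, t₀ y), ht₀ y⟩, rfl⟩
      perfect := by
        rintro ⟨⟨y, t⟩, ha⟩ O hO
        rw [nhds_subtype_eq_comap] at hO
        obtain ⟨V, hV, hVO⟩ := hO
        have hc : Continuous fun t : BinFin => (y, t) := by fun_prop
        obtain ⟨t', h1, h2, h3⟩ := BinFin.exists_ne_idx_ge t (hc.continuousAt.preimage_mem_nhds hV)
          (BinFin.idx t)
        exact ⟨⟨(y, t'), S.Kp_mono k h3 ha⟩, hVO h1,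
          fun h => h2 (congrArg (fun a : S.Labels k => a.1.2) h), rfl⟩
      closed := fun j => Pt.isClosed_Kp S k j
      cover := fun y => S.Kp_cover k y.pt
      sections := by
        rintro j ⟨⟨y, t⟩, ha⟩ O hO
        rw [nhds_subtype_eq_comap] at hO
        obtain ⟨V, hV, hVO⟩ := hO
        obtain ⟨V₁, hV₁, V₂, hV₂, hVV⟩ := mem_nhds_prod_iff.1 hV
        obtain ⟨t', h1, -, h3⟩ := BinFin.exists_ne_idx_ge t hV₂ j
        have hmem : ∀ z : S.Pt, z.pt ∈ S.Kp k j → (z, t') ∈ S.Labels k := fun z hz =>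
          S.Kp_mono k h3 hz
        refine ⟨V₁, hV₁, sec t', (hsecc t').mono fun z hz => hmem z hz.1, fun z hz => ?_⟩
        have h := hsec t' z (hmem z hz.1)
        refine ⟨congrArg Prod.fst h, hVO ?_⟩
        rw [mem_preimage, h]
        exact hVV ⟨hz.2, h1⟩
      closedE := fun m => Pt.isClosed_Kp S k (BinFin.idx (e m))
      contσ := fun m => hsecc (e m)
      section_eq := fun m y hy => congrArg Prod.fst (hsec _ _ hy)
      exhaust := by
        rintro ⟨⟨y, t⟩, ha⟩
        obtain ⟨m, rfl⟩ := he t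
        exact ⟨m, ha, Subtype.ext (hsec _ _ ha)⟩ }
  exact hfib.exists_homeomorph

end Strat

namespace Strat

variable {Y : Type*} (S : Strat Y) [Nonempty Y]

/-- Truncation of a sequence. -/
def trunc {A : Type*} [Inhabited A] (n : ℕ) (u : ℕ → A) (k : ℕ) : A :=
  if k < n then u k else default

theorem continuous_trunc {A : Type*} [Inhabited A] [TopologicalSpace A] (n : ℕ) :
    Continuous (trunc (A := A) n) := by
  refine continuous_pi fun k => ?_
  by_cases hk : k < n
  · simpa [trunc, hk] using continuous_apply k
  · simpa [trunc, hk] using continuous_const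

theorem trunc_trunc {A : Type*} [Inhabited A] {m n : ℕ} (h : m ≤ n) (u : ℕ → A) :
    trunc m (trunc n u) = trunc m u := by
  funext k
  by_cases hk : k < m
  · simp [trunc, hk, hk.trans_le h]
  · simp [trunc, hk]

/-- The finite stages: a representative of level `n` together with `n` allowed labels. -/
def Stage (n : ℕ) : Set (S.Pt × (ℕ → ℕ × BinFin)) :=
  {a | S.r n a.1.pt = a.1.pt ∧ (∀ k < n, a.1.pt ∈ S.Kp k (BinFin.idx (a.2 k).2)) ∧
    ∀ k, n ≤ k → a.2 k = default}

/-- The projection to the `n`-th stage. -/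
def proj (n : ℕ) (a : S.Pt × (ℕ → ℕ × BinFin)) : S.Pt × (ℕ → ℕ × BinFin) :=
  (⟨S.r n a.1.pt⟩, trunc n a.2)

theorem continuous_proj (n : ℕ) : Continuous (S.proj n) :=
  ((Pt.continuous_r S n).comp continuous_fst).prodMk ((continuous_trunc n).comp continuous_snd)

theorem proj_mem {n : ℕ} {a : S.Pt × (ℕ → ℕ × BinFin)}
    (h : ∀ k < n, a.1.pt ∈ S.Kp k (BinFin.idx (a.2 k).2)) : S.proj n a ∈ S.Stage n := by
  refine ⟨S.r_r_of_le le_rfl _, fun k hk => ?_, fun k hk => ?_⟩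
  · simpa [proj, trunc, hk] using S.r_mem_Kp (h k hk) n
  · simp [proj, trunc, hk]

theorem proj_proj {m n : ℕ} (h : m ≤ n) (a : S.Pt × (ℕ → ℕ × BinFin)) :
    S.proj m (S.proj n a) = S.proj m a := by
  simp only [proj, S.r_r_of_le h, trunc_trunc h]

theorem countable_stage (n : ℕ) : (S.Stage n).Countable := by
  have h1 : Countable {x | S.r n x = x} := S.countable_fixed n
  rw [← countable_coe_iff]
  let f : S.Stage n → {x | S.r n x = x} × (Fin n → ℕ × BinFin) :=
    fun a => (⟨a.1.1.pt, a.2.1⟩, fun k => a.1.2 k)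
  refine Function.Injective.countable (f := f) ?_
  rintro ⟨⟨x, u⟩, ha⟩ ⟨⟨y, v⟩, hb⟩ h
  simp only [f, Prod.mk.injEq, Subtype.mk.injEq] at h
  refine Subtype.ext (Prod.ext (Pt.ext h.1) (funext fun k => ?_))
  by_cases hk : k < n
  · exact congrFun h.2 ⟨k, hk⟩
  · rw [ha.2.2 k (not_lt.1 hk), hb.2.2 k (not_lt.1 hk)]

theorem eventually_stage {n : ℕ} (a : S.Stage n) : ∀ᶠ b : S.Stage n in 𝓝 a, b.1.1 = a.1.1 := by
  have hc : Continuous fun b : S.Stage n => b.1.1 := by fun_prop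
  filter_upwards [hc.continuousAt.eventually (Pt.eventually_c S n a.1.1)] with b hb
  apply Pt.ext
  rw [← b.2.1, ← a.2.1]
  exact S.r_congr hb

theorem isCode_stage (n : ℕ) :
    ∃ (D : Type) (c : ℕ → S.Stage n → D), IsCode c :=
  ⟨_, _, ((Pt.isCode S).prod ((IsCode.of_discrete ℕ).prod BinFin.isCode).pi).subtype⟩

/-- The height at level `n` after absorbing the increase of `η`. -/
def height (n : ℕ) (a : S.Pt × (ℕ → ℕ × BinFin)) : ℕ :=
  ⌊2 ^ n * max 0 (S.η a.1.pt - S.η (S.r n a.1.pt))⌋₊ + (a.2 n).1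

/-- One step of the tower of stages. -/
def step (n : ℕ) (a : S.Stage (n + 1)) : S.Stage n × ℕ :=
  (⟨S.proj n a, S.proj_mem fun k hk => a.2.2.1 k (hk.trans n.lt_succ_self)⟩, S.height n a)

theorem continuous_step (n : ℕ) : Continuous (S.step n) := by
  refine (Continuous.subtype_mk ((S.continuous_proj n).comp continuous_subtype_val) _).prodMk ?_
  rw [continuous_iff_continuousAt]
  intro a
  have hc : Continuous fun b : S.Stage (n + 1) => (b.1.2 n).1 := by fun_prop
  have h2 : ∀ᶠ b : S.Stage (n + 1) in 𝓝 a, (b.1.2 n).1 = (a.1.2 n).1 :=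
    hc.continuousAt.eventually_mem (mem_nhds_discrete.2 rfl : {(a.1.2 n).1} ∈ 𝓝 _)
  refine (continuousAt_const (y := S.height n a)).congr ?_
  filter_upwards [S.eventually_stage a, h2] with b h1 h2
  rw [height, height, h1, h2]

theorem trunc_update {A : Type*} [Inhabited A] {n : ℕ} {u : ℕ → A} (hu : ∀ k, n ≤ k → u k = default)
    (x : A) : trunc n (Function.update u n x) = u := by
  funext k
  by_cases hk : k < n
  · simp [trunc, hk, hk.ne]
  · simp [trunc, hk, hu k (not_lt.1 hk)]

theorem update_mem_stage {n : ℕ} {x : S.Pt} {u : ℕ → ℕ × BinFin} {z : ℕ × BinFin}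
    (hx : S.r (n + 1) x.pt = x.pt) (hu : ∀ k < n, x.pt ∈ S.Kp k (BinFin.idx (u k).2))
    (hd : ∀ k, n ≤ k → u k = default) (hz : x.pt ∈ S.Kp n (BinFin.idx z.2)) :
    (x, Function.update u n z) ∈ S.Stage (n + 1) := by
  refine ⟨hx, fun k hk => ?_, fun k hk => ?_⟩
  · rcases (Nat.lt_succ_iff.1 hk).lt_or_eq with h | rfl
    · simpa [h.ne] using hu k h
    · simpa using hz
  · have : k ≠ n := by omega
    simpa [this] using hd k (by omega)

theorem isOpenMap_step (n : ℕ) : IsOpenMap (S.step n) := by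
  refine IsOpenMap.of_nhds_le ?_
  rintro a U hU
  rw [mem_map, nhds_subtype_eq_comap] at hU
  obtain ⟨V, hV, hVU⟩ := hU
  let g : S.Stage n × ℕ → S.Pt × (ℕ → ℕ × BinFin) := fun b =>
    (a.1.1, Function.update b.1.1.2 n (a.1.2 n))
  have hg : Continuous g := by
    refine continuous_const.prodMk (Continuous.update ?_ n continuous_const)
    fun_prop
  have hga : g (S.step n a) = a.1 := by
    refine Prod.ext rfl (funext fun k => ?_)
    rcases lt_trichotomy k n with h | rfl | h
    · simp [g, h.ne, step, proj, trunc, h]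
    · simp [g]
    · simp [g, h.ne', step, proj, trunc, h.not_gt, a.2.2.2 k h]
  have h1 : ∀ᶠ b in 𝓝 (S.step n a), g b ∈ V := hg.continuousAt.eventually_mem (by rwa [hga])
  have hc1 : Continuous fun b : S.Stage n × ℕ => b.1 := by fun_prop
  have h2 : ∀ᶠ b in 𝓝 (S.step n a), b.1.1.1 = (S.step n a).1.1.1 :=
    hc1.continuousAt.eventually (S.eventually_stage (S.step n a).1)
  have hc2 : Continuous fun b : S.Stage n × ℕ => b.2 := by fun_prop
  have h3 : ∀ᶠ b in 𝓝 (S.step n a), b.2 = (S.step n a).2 :=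
    hc2.continuousAt.eventually_mem (mem_nhds_discrete.2 rfl : {(S.step n a).2} ∈ 𝓝 _)
  have h4 : ∀ᶠ b in 𝓝 (S.step n a), ∀ k ∈ Iio n,
      BinFin.idx ((S.step n a).1.1.2 k).2 ≤ BinFin.idx (b.1.1.2 k).2 := by
    rw [eventually_all_finite (finite_Iio n)]
    intro k _
    have hc : Continuous fun b : S.Stage n × ℕ => (b.1.1.2 k).2 := by fun_prop
    exact hc.continuousAt.eventually (BinFin.eventually_idx_le _)
  filter_upwards [h1, h2, h3, h4] with b h1 h2 h3 h4
  have hmem : g b ∈ S.Stage (n + 1) := by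
    refine S.update_mem_stage a.2.1 (fun k hk => ?_) b.1.2.2.2 (a.2.2.1 n n.lt_succ_self)
    refine S.Kp_mono k (h4 k hk) ?_
    simpa [step, proj, trunc, hk] using a.2.2.1 k (Nat.lt_succ_of_lt hk)
  have hb : S.step n ⟨g b, hmem⟩ = b := by
    refine Prod.ext (Subtype.ext (Prod.ext h2.symm (trunc_update b.1.2.2.2 _))) ?_
    rw [h3]
    simp [step, height, g]
  have := hVU (show (⟨g b, hmem⟩ : S.Stage (n + 1)) ∈ Subtype.val ⁻¹' V from h1)
  rwa [mem_preimage, hb] at this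

theorem surjective_step (n : ℕ) : Function.Surjective (S.step n) := by
  rintro ⟨⟨⟨x, u⟩, hb⟩, l⟩
  obtain ⟨j, hj⟩ := S.Kp_cover n x.pt
  obtain ⟨t, -, -, ht⟩ := BinFin.exists_ne_idx_ge default univ_mem j
  refine ⟨⟨(x, Function.update u n (l, t)), S.update_mem_stage (S.r_fix_of_le n.le_succ hb.1)
    hb.2.1 hb.2.2 (S.Kp_mono n ht hj)⟩, Prod.ext (Subtype.ext (Prod.ext (Pt.ext hb.1)
      (trunc_update hb.2.2 _))) ?_⟩
  have : S.r n x.pt = x.pt := hb.1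
  simp [step, height, this]

/-- The only element of the first stage. -/
def base : S.Stage 0 :=
  ⟨(⟨S.r 0 (Classical.arbitrary Y)⟩, fun _ => default), S.r_r_of_le le_rfl _,
    fun _ h => (Nat.not_lt_zero _ h).elim, fun _ _ => rfl⟩

theorem eq_base (a : S.Stage 0) : a = S.base :=
  Subtype.ext (Prod.ext (Pt.ext (a.2.1.symm.trans (S.r_zero _ _)))
    (funext fun k => a.2.2.2 k k.zero_le))

theorem nonempty_stage (n : ℕ) : Nonempty (S.Stage n) := by
  induction n with
  | zero => exact ⟨S.base⟩
  | succ n ih => exact (S.surjective_step n).nonempty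

theorem exists_stage_homeomorph (n : ℕ) :
    ∃ φ : S.Stage (n + 1) ≃ₜ (S.Stage n × ℕ) × BinFin, ∀ a, (φ a).1 = S.step n a := by
  have := (S.countable_stage (n + 1)).to_subtype
  obtain ⟨D, c, hc⟩ := S.isCode_stage (n + 1)
  obtain ⟨D', c', hc'⟩ := S.isCode_stage n
  have := S.nonempty_stage (n + 1)
  refine exists_fiber_homeomorph_of_countable hc (hc'.prod (IsCode.of_discrete ℕ))
    (S.continuous_step n) (S.isOpenMap_step n) (S.surjective_step n) ?_
  rintro ⟨⟨x, u⟩, ha⟩ O hO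
  rw [nhds_subtype_eq_comap] at hO
  obtain ⟨V, hV, hVO⟩ := hO
  let g : BinFin → S.Pt × (ℕ → ℕ × BinFin) := fun t => (x, Function.update u n ((u n).1, t))
  have hg : Continuous g :=
    continuous_const.prodMk (Continuous.update continuous_const n (by fun_prop))
  have hg0 : g (u n).2 = (x, u) := by simp [g]
  obtain ⟨t, h1, h2, h3⟩ := BinFin.exists_ne_idx_ge (u n).2
    (hg.continuousAt.preimage_mem_nhds (by rwa [hg0])) (BinFin.idx (u n).2)
  have hmem : g t ∈ S.Stage (n + 1) := by
    refine ⟨ha.1, fun k hk => ?_, fun k hk => ?_⟩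
    · rcases (Nat.lt_succ_iff.1 hk).lt_or_eq with h | rfl
      · simpa [g, h.ne] using ha.2.1 k hk
      · simpa [g] using S.Kp_mono k h3 (ha.2.1 k hk)
    · have : k ≠ n := by omega
      simpa [g, this] using ha.2.2 k hk
  refine ⟨⟨g t, hmem⟩, hVO h1, fun h => h2 ?_, ?_⟩
  · have := congrArg (fun a : S.Stage (n + 1) => (a.1.2 n).2) h
    simpa [g] using this
  · refine Prod.ext (Subtype.ext (Prod.ext rfl (funext fun k => ?_))) ?_
    · by_cases hk : k < n
      · simp [step, proj, trunc, g, hk, hk.ne]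
      · simp [step, proj, trunc, hk]
    · simp [step, height, g]

end Strat

theorem Ladder.continuous_val : Continuous fun v : Ladder => v.1 := continuous_subtype_val

theorem Ladder.lowerSemicontinuous_weight : LowerSemicontinuous Ladder.weight := by
  intro x a ha
  have hs : ∀ y : Ladder, ∀ n, 0 ≤ ((y.1 n).1 : ℝ) * (1 / 2) ^ n := fun y n => by positivity
  obtain ⟨s, hs'⟩ := (x.2.hasSum.eventually (lt_mem_nhds ha)).exists
  have h : ∀ᶠ y : Ladder in 𝓝 x, ∀ n ∈ s, (y.1 n).1 = (x.1 n).1 := by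
    rw [eventually_all_finset]
    intro n _
    have hc : Continuous fun y : Ladder => (y.1 n).1 :=
      continuous_fst.comp ((continuous_apply n).comp continuous_subtype_val)
    exact hc.continuousAt.eventually_mem (mem_nhds_discrete.2 rfl : {(x.1 n).1} ∈ 𝓝 _)
  filter_upwards [h] with y hy
  refine lt_of_lt_of_le ?_ (y.2.sum_le_tsum s fun n _ => hs y n)
  rwa [Finset.sum_congr rfl fun n hn => by rw [hy n hn]]

namespace Strat

variable {Y : Type*} (S : Strat Y) [Nonempty Y]

/-- Points with a ladder whose labels are all allowed. -/
def Limit : Set (S.Pt × Ladder) := {a | ∀ k, a.1.pt ∈ S.Kp k (BinFin.idx (a.2.1 k).2)}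

theorem exists_limit_homeomorph :
    ∃ φ : S.Limit ≃ₜ S.Pt × Ladder, ∀ a, (φ a).1 = a.1.1 ∧ (φ a).2.weight = a.1.2.weight := by
  choose φ hφ using S.exists_labels_homeomorph
  have hφs : ∀ k z, ((φ k).symm z).1.1 = z.1 := fun k z => by
    rw [← hφ, (φ k).apply_symm_apply]
  have hcoord : ∀ k, Continuous fun v : Ladder => v.1 k := fun k =>
    (continuous_apply k).comp continuous_subtype_val
  let lab (k : ℕ) (a : S.Limit) : S.Labels k := ⟨(a.1.1, (a.1.2.1 k).2), a.2 k⟩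
  have hlab : ∀ k, Continuous (lab k) := fun k => Continuous.subtype_mk
    ((continuous_fst.comp continuous_subtype_val).prodMk
      (continuous_snd.comp ((hcoord k).comp (continuous_snd.comp continuous_subtype_val)))) _
  refine ⟨⟨⟨fun a => (a.1.1, ⟨fun k => ((a.1.2.1 k).1, (φ k (lab k a)).2), a.1.2.2⟩),
    fun b => ⟨(b.1, ⟨fun k => ((b.2.1 k).1, ((φ k).symm (b.1, (b.2.1 k).2)).1.2), b.2.2⟩),
      fun k => ?_⟩, fun a => ?_, fun b => ?_⟩, ?_, ?_⟩, fun a => ⟨rfl, rfl⟩⟩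
  · have h : ((φ k).symm (b.1, (b.2.1 k).2)).1.1.pt ∈
        S.Kp k (BinFin.idx ((φ k).symm (b.1, (b.2.1 k).2)).1.2) := ((φ k).symm _).2
    rw [hφs] at h
    exact h
  · refine Subtype.ext (Prod.ext rfl (Subtype.ext (funext fun k => Prod.ext rfl ?_)))
    have : (a.1.1, (φ k (lab k a)).2) = φ k (lab k a) :=
      Prod.ext (show a.1.1 = _ from (hφ k (lab k a)).symm) rfl
    change ((φ k).symm (a.1.1, (φ k (lab k a)).2)).1.2 = _
    rw [this, (φ k).symm_apply_apply]
  · refine Prod.ext rfl (Subtype.ext (funext fun k => Prod.ext rfl ?_))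
    change (φ k _).2 = _
    have : ∀ (z : S.Labels k), z = (φ k).symm (b.1, (b.2.1 k).2) → (φ k z).2 = (b.2.1 k).2 := by
      rintro z rfl
      rw [(φ k).apply_symm_apply]
    refine this _ (Subtype.ext (Prod.ext ?_ rfl))
    exact (hφs k (b.1, (b.2.1 k).2)).symm
  · refine (continuous_fst.comp continuous_subtype_val).prodMk
      (Continuous.subtype_mk (continuous_pi fun k => ?_) _)
    exact
      (continuous_fst.comp ((hcoord k).comp (continuous_snd.comp continuous_subtype_val))).prodMk
      (continuous_snd.comp ((φ k).continuous.comp (hlab k)))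
  · refine Continuous.subtype_mk (continuous_fst.prodMk
      (Continuous.subtype_mk (continuous_pi fun k => ?_) _)) _
    have h := (hcoord k).comp (continuous_snd (X := S.Pt))
    exact (continuous_fst.comp h).prodMk (continuous_snd.comp (continuous_subtype_val.comp
      ((φ k).symm.continuous.comp (continuous_fst.prodMk (continuous_snd.comp h)))))

/-- The `n`-th stage of a point of the limit. -/
def toStage (n : ℕ) (a : S.Limit) : S.Stage n :=
  ⟨S.proj n (a.1.1, a.1.2.1), S.proj_mem fun k _ => a.2 k⟩

theorem continuous_toStage (n : ℕ) : Continuous (S.toStage n) :=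
  Continuous.subtype_mk ((S.continuous_proj n).comp
    ((continuous_fst.comp continuous_subtype_val).prodMk
      (Ladder.continuous_val.comp (continuous_snd.comp continuous_subtype_val)))) _

theorem step_toStage (n : ℕ) (a : S.Limit) :
    S.step n (S.toStage (n + 1) a) =
      (S.toStage n a, ⌊2 ^ n * S.inc n a.1.1.pt⌋₊ + (a.1.2.1 n).1) := by
  refine Prod.ext (Subtype.ext (S.proj_proj n.le_succ _)) ?_
  simp only [step, height, toStage, proj, trunc, inc,
    S.r_r_of_le n.le_succ, n.lt_succ_self, if_true]

/-- The rounding error at level `n`. -/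
def roundErr (n : ℕ) (y : Y) : ℝ := ⌊2 ^ n * S.inc n y⌋₊ * (1 / 2) ^ n - S.inc n y

theorem abs_roundErr_le (n : ℕ) (y : Y) : |S.roundErr n y| ≤ (1 / 2) ^ n := by
  have h0 := S.inc_nonneg n y
  have h1 : (⌊2 ^ n * S.inc n y⌋₊ : ℝ) ≤ 2 ^ n * S.inc n y := Nat.floor_le (by positivity)
  have h2 : 2 ^ n * S.inc n y < ⌊2 ^ n * S.inc n y⌋₊ + 1 := Nat.lt_floor_add_one _
  have h3 : S.inc n y = (2 ^ n * S.inc n y) * (1 / 2) ^ n := by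
    rw [one_div, inv_pow]; field_simp
  have h4 : S.roundErr n y = (⌊2 ^ n * S.inc n y⌋₊ - 2 ^ n * S.inc n y) * (1 / 2) ^ n := by
    rw [roundErr, sub_mul, ← h3]
  rw [h4, abs_mul, abs_of_pos (by positivity : (0 : ℝ) < (1 / 2) ^ n)]
  refine mul_le_of_le_one_left (by positivity) ?_
  rw [abs_le]
  constructor <;> linarith

theorem summable_roundErr (y : Y) : Summable fun n => S.roundErr n y :=
  Summable.of_norm_bounded summable_geometric_two fun n => S.abs_roundErr_le n y

theorem continuous_tsum_roundErr : Continuous fun x : S.Pt => ∑' n, S.roundErr n x.pt := by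
  refine continuous_tsum (fun n => ?_) summable_geometric_two fun n x => S.abs_roundErr_le n x.pt
  rw [continuous_iff_continuousAt]
  intro x
  refine (continuousAt_const (y := S.roundErr n x.pt)).congr ?_
  filter_upwards [Pt.eventually_c S (n + 1) x] with y hy
  rw [roundErr, roundErr, inc, inc, S.r_congr hy, S.r_congr (S.refine_succ _ _ _ hy)]

theorem hasSum_height (a : S.Limit) :
    HasSum (fun n => ((S.step n (S.toStage (n + 1) a)).2 : ℝ) * (1 / 2) ^ n)
      (∑' n, S.roundErr n a.1.1.pt + (S.η a.1.1.pt - S.η (S.r 0 a.1.1.pt) + S.totalDec a.1.1.pt)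
        + a.1.2.weight) := by
  have h := ((S.summable_roundErr a.1.1.pt).hasSum.add (S.hasSum_inc a.1.1.pt)).add a.1.2.2.hasSum
  rw [show (fun n => ((S.step n (S.toStage (n + 1) a)).2 : ℝ) * (1 / 2) ^ n) =
      fun n => S.roundErr n a.1.1.pt + S.inc n a.1.1.pt + ((a.1.2.1 n).1 : ℝ) * (1 / 2) ^ n from
    funext fun n => by rw [S.step_toStage, roundErr]; push_cast; ring]
  exact h

theorem exists_ladder_homeomorph : ∃ Φ : S.Limit ≃ₜ Ladder,
    ∀ a n, ((Φ a).1 n).1 = (S.step n (S.toStage (n + 1) a)).2 := by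
  choose ψ hψ using S.exists_stage_homeomorph
  let f (a : S.Limit) : Ladder :=
    ⟨fun n => ((S.step n (S.toStage (n + 1) a)).2, (ψ n (S.toStage (n + 1) a)).2),
      (S.hasSum_height a).summable⟩
  have hf : Continuous f := Continuous.subtype_mk (continuous_pi fun n =>
    (continuous_snd.comp ((S.continuous_step n).comp (S.continuous_toStage (n + 1)))).prodMk
      (continuous_snd.comp ((ψ n).continuous.comp (S.continuous_toStage (n + 1))))) _
  let g (v : Ladder) : ∀ n, S.Stage n := fun n =>
    Nat.rec S.base (fun n a => (ψ n).symm ((a, (v.1 n).1), (v.1 n).2)) n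
  have hgs : ∀ v n, g v (n + 1) = (ψ n).symm ((g v n, (v.1 n).1), (v.1 n).2) := fun _ _ => rfl
  have hcoord : ∀ k, Continuous fun v : Ladder => v.1 k := fun k =>
    (continuous_apply k).comp continuous_subtype_val
  have hgc : ∀ n, Continuous fun v => g v n := by
    intro n
    induction n with
    | zero => exact continuous_const
    | succ n ih =>
      exact (ψ n).symm.continuous.comp ((ih.prodMk (continuous_fst.comp (hcoord n))).prodMk
        (continuous_snd.comp (hcoord n)))
  have hstep : ∀ v n, S.step n (g v (n + 1)) = (g v n, (v.1 n).1) := fun v n => by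
    rw [hgs, ← hψ, (ψ n).apply_symm_apply]
  have hgf : ∀ a n, g (f a) n = S.toStage n a := by
    intro a n
    induction n with
    | zero => exact (S.eq_base _).symm
    | succ n ih =>
      rw [hgs, ih, Homeomorph.symm_apply_eq]
      refine Prod.ext ?_ rfl
      rw [hψ, S.step_toStage]
      refine Prod.ext rfl ?_
      change (S.step n (S.toStage (n + 1) a)).2 = _
      rw [S.step_toStage]
  have hproj : ∀ v n, S.proj n (g v (n + 1)).1 = (g v n).1 := fun v n =>
    congrArg (fun z : S.Stage n × ℕ => z.1.1) (hstep v n)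
  have hlim : ∀ v, ∃ a, ∀ n, S.toStage n a = g v n := by
    intro v
    let u : ℕ → ℕ × BinFin := fun k => (g v (k + 1)).1.2 k
    have hu : ∀ k m, k < m → (g v m).1.2 k = u k := by
      intro k m hkm
      induction m, hkm using Nat.le_induction with
      | base => rfl
      | succ m hm ih =>
        rw [← ih, ← hproj v m]
        simp [proj, trunc, Nat.lt_of_succ_le hm]
    obtain ⟨y, hy, hyK⟩ := S.exists_limit (x := fun n => (g v n).1.1.pt)
      (j := fun k => BinFin.idx (u k).2)
      (fun n => congrArg (fun z : S.Pt × (ℕ → ℕ × BinFin) => z.1.pt) (hproj v n))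
      (fun k m hkm => by
        rw [← hu k m hkm]
        exact (g v m).2.2.1 k hkm)
    have hsum : Summable fun n => ((u n).1 : ℝ) * (1 / 2) ^ n := by
      refine Summable.of_nonneg_of_le (fun n => by positivity) (fun n => ?_) v.2
      have h : (v.1 n).1 = S.height n (g v (n + 1)).1 :=
        (congrArg (fun z : S.Stage n × ℕ => z.2) (hstep v n)).symm
      rw [h, height]
      gcongr
      exact Nat.le_add_left _ _
    refine ⟨⟨(⟨y⟩, ⟨u, hsum⟩), hyK⟩, fun n => Subtype.ext (Prod.ext (Pt.ext (hy n)) ?_)⟩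
    funext k
    by_cases hk : k < n
    · simpa [toStage, proj, trunc, hk] using (hu k n hk).symm
    · simpa [toStage, proj, trunc, hk] using ((g v n).2.2.2 k (not_lt.1 hk)).symm
  choose G hG using hlim
  have hext : ∀ a b : S.Limit, (∀ n, S.toStage n a = S.toStage n b) → a = b := by
    intro a b h
    have h' := fun n => congrArg (fun z : S.Stage n => z.1) (h n)
    refine Subtype.ext (Prod.ext (Pt.ext (S.eq_of_forall_r fun n =>
      congrArg (fun z : S.Pt × (ℕ → ℕ × BinFin) => z.1.pt) (h' n)))
      (Subtype.ext (funext fun k => ?_)))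
    have := congrArg (fun z : S.Pt × (ℕ → ℕ × BinFin) => z.2 k) (h' (k + 1))
    simpa [toStage, proj, trunc] using this
  refine ⟨⟨⟨f, G, fun a => hext _ _ fun n => by rw [hG, hgf], fun v => ?_⟩, hf, ?_⟩, fun a n => rfl⟩
  · refine Subtype.ext (funext fun n => ?_)
    change ((S.step n (S.toStage (n + 1) (G v))).2, (ψ n (S.toStage (n + 1) (G v))).2) = v.1 n
    rw [hG, hstep, hgs, (ψ n).apply_symm_apply]
  · refine Continuous.subtype_mk (Continuous.prodMk (f := fun v => (G v).1.1) ?_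
      (Continuous.subtype_mk (f := fun v => (G v).1.2.1) (continuous_pi fun k => ?_) _)) _
    · rw [(Pt.isInducing S).continuous_iff]
      refine continuous_pi fun n => ?_
      have h1 : Continuous fun v => S.c n (g v n).1.1.pt :=
        (continuous_apply n).comp ((Pt.isInducing S).continuous.comp
          (continuous_fst.comp (continuous_subtype_val.comp (hgc n))))
      refine h1.congr fun v => ?_
      rw [← hG]
      exact S.c_r n _
    · have h1 : Continuous fun v => (g v (k + 1)).1.2 k :=
        (continuous_apply k).comp (continuous_snd.comp (continuous_subtype_val.comp (hgc (k + 1))))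
      refine h1.congr fun v => ?_
      have h2 := congrArg (fun z : S.Stage (k + 1) => z.1.2 k) (hG v (k + 1))
      simpa [toStage, proj, trunc] using h2.symm

/-- A space topologised by a stratification is a factor of Erdős space. -/
theorem prod_erdosSpace [TopologicalSpace Y]
    (h : IsInducing fun y => ((fun n => S.c n y), S.η y)) :
    Nonempty (Y × ErdosSpace ≃ₜ ErdosSpace) := by
  obtain ⟨e⟩ := exists_homeomorph_ladder
  obtain ⟨φ, hφ⟩ := S.exists_limit_homeomorph
  obtain ⟨Φ, hΦ⟩ := S.exists_ladder_homeomorph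
  have hφs : ∀ z, (φ.symm z).1.1 = z.1 ∧ (φ.symm z).1.2.weight = z.2.weight := fun z => by
    rw [← (hφ (φ.symm z)).1, ← (hφ (φ.symm z)).2, φ.apply_symm_apply]
    exact ⟨rfl, rfl⟩
  let y₀ : Y := Classical.arbitrary Y
  have hdiff : ∀ z : S.Pt × Ladder, (Φ (φ.symm z)).weight - (S.η z.1.pt + z.2.weight) =
      ∑' n, S.roundErr n z.1.pt + S.totalDec z.1.pt - S.η (S.r 0 y₀) := fun z => by
    have h1 : (Φ (φ.symm z)).weight = _ :=
      (tsum_congr fun n => by rw [hΦ]).trans (S.hasSum_height (φ.symm z)).tsum_eq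
    rw [h1, (hφs z).1, (hφs z).2, S.r_zero z.1.pt y₀]
    ring
  refine ⟨((Pt.homeomorph S h).prodCongr e).trans ((Gr.prod (Pt.lowerSemicontinuous_η S)
    Ladder.lowerSemicontinuous_weight).trans ((Gr.congr (φ.symm.trans Φ) ?_).trans e.symm))⟩
  refine Continuous.congr ?_ fun z => (hdiff z).symm
  exact ((S.continuous_tsum_roundErr.comp continuous_fst).add
    ((Pt.continuous_totalDec S).comp continuous_fst)).sub continuous_const

end Strat

namespace Strat

variable {Y : Type*} (S : Strat Y)

/-- The topology is the one given by the partitions and the height. -/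
def Induces [TopologicalSpace Y] : Prop := IsInducing fun y => ((fun n => S.c n y), S.η y)

/-- The filter of neighbourhoods given by the partitions and the height. -/
def nhd (y : Y) : Filter Y := comap (fun y => ((fun n => S.c n y), S.η y)) (𝓝 ((S.c · y), S.η y))

theorem eventually_nhd_c (n : ℕ) (y : Y) : ∀ᶠ y' in S.nhd y, S.c n y' = S.c n y := by
  have h : Continuous fun p : (ℕ → ℕ) × ℝ => p.1 n := by fun_prop
  exact ((h.continuousAt (x := ((S.c · y), S.η y))).eventually_mem
    (mem_nhds_discrete.2 rfl : {S.c n y} ∈ 𝓝 _)).comap _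

theorem eventually_nhd_η {y : Y} {ε : ℝ} (hε : 0 < ε) : ∀ᶠ y' in S.nhd y, S.η y' < S.η y + ε := by
  have h : Continuous fun p : (ℕ → ℕ) × ℝ => p.2 := by fun_prop
  exact (h.continuousAt.eventually (gt_mem_nhds (lt_add_of_pos_right (S.η y) hε))).comap _

theorem exists_of_mem_nhd {y : Y} {U : Set Y} (hU : U ∈ S.nhd y) :
    ∃ n, ∃ ε > 0, ∀ y', S.c n y' = S.c n y → S.η y' < S.η y + ε → y' ∈ U := by
  obtain ⟨V, hV, hVU⟩ := hU
  obtain ⟨V₁, hV₁, V₂, hV₂, hVV⟩ := mem_nhds_prod_iff.1 hV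
  obtain ⟨n, -, hn⟩ := (IsCode.of_discrete ℕ).pi.exists_cone hV₁ 0
  obtain ⟨ε, hε, hball⟩ := Metric.mem_nhds_iff.1 hV₂
  obtain ⟨m, hm⟩ := S.lsc y ε hε
  refine ⟨max n m, ε, hε, fun y' hc hη => hVU (hVV ⟨hn _ ?_, hball ?_⟩)⟩
  · funext k
    by_cases hk : k < n
    · simp [hk, S.c_mono (hk.le.trans (le_max_left n m)) hc]
    · simp [hk]
  · have := hm y' (S.c_mono (le_max_right n m) hc)
    rw [Metric.mem_ball, Real.dist_eq, abs_lt]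
    constructor <;> linarith

theorem Induces.nhds_eq [TopologicalSpace Y] {S : Strat Y} (h : S.Induces) (y : Y) :
    𝓝 y = S.nhd y := h.nhds_eq_comap y

theorem induces_of [TopologicalSpace Y] (hc : ∀ n y, ∀ᶠ y' in 𝓝 y, S.c n y' = S.c n y)
    (hη : Continuous S.η) (h : ∀ y, S.nhd y ≤ 𝓝 y) : S.Induces := by
  rw [Induces, isInducing_iff_nhds]
  refine fun y => le_antisymm ?_ (h y)
  rw [← map_le_iff_le_comap]
  have hcont : Continuous fun y n => S.c n y := continuous_pi fun n => by
    rw [continuous_iff_continuousAt]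
    intro y
    exact (continuousAt_const (y := S.c n y)).congr ((hc n y).mono fun y' h => h.symm)
  exact (hcont.prodMk hη).continuousAt

/-- A closed subspace of a stratified space is stratified. -/
theorem exists_of_isClosedEmbedding [TopologicalSpace Y] (hS : S.Induces) {X : Type*}
    [TopologicalSpace X] {e : X → Y} (he : IsClosedEmbedding e) : ∃ T : Strat X, T.Induces := by
  obtain ⟨E, hE⟩ := exists_surjective_nat (ℕ × ℕ × ℚ)
  let B (k : ℕ) : Set Y := {w | S.c (E k).1 w = (E k).2.1 ∧ S.η w ≤ (E k).2.2}
  let T : Strat X :=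
    { c := fun n x => S.c n (e x)
      η := fun x => S.η (e x)
      K := fun k j => {x | e x ∈ S.K k j ∧
        ((∀ x, e x ∉ B k) → ∀ w ∈ B k, S.c j w ≠ S.c j (e x))}
      refine_succ := fun n x y h => S.refine_succ n _ _ h
      c_zero := fun x y => S.c_zero _ _
      sep := fun x y h => he.injective (S.sep _ _ h)
      nonneg := fun y => S.nonneg _
      lsc := fun y ε hε => (S.lsc (e y) ε hε).imp fun n hn y' hy' => hn _ hy'
      K_mono := fun k i j hij x hx => ⟨S.K_mono k hij hx.1, fun hB w hw hc =>
        hx.2 hB w hw (S.c_mono hij hc)⟩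
      K_cover := by
        intro k x
        obtain ⟨j, hj⟩ := S.K_cover k (e x)
        by_cases hB : ∀ x, e x ∉ B k
        · have : ∃ i, ∀ w ∈ B k, S.c i w ≠ S.c i (e x) := by
            by_cases hc : S.c (E k).1 (e x) = (E k).2.1
            · have hlt : (E k).2.2 < S.η (e x) := lt_of_not_ge fun h => hB x ⟨hc, h⟩
              obtain ⟨n, hn⟩ := S.lsc (e x) _ (sub_pos.2 hlt)
              refine ⟨n, fun w hw hcw => ?_⟩
              have := hn w hcw
              linarith [hw.2]
            · exact ⟨(E k).1, fun w hw hcw => hc (hcw ▸ hw.1)⟩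
          obtain ⟨i, hi⟩ := this
          exact ⟨max i j, S.K_mono k (le_max_right _ _) hj, fun _ w hw hcw =>
            hi w hw (S.c_mono (le_max_left _ _) hcw)⟩
        · exact ⟨j, hj, fun h => (hB h).elim⟩
      complete := by
        intro j z h
        obtain ⟨y, hy, hyK⟩ := S.complete j z fun k m =>
          (h k m).elim fun x hx => ⟨e x, hx.1.1, hx.2⟩
        have hmiss : ∀ k, (∀ x, e x ∉ B k) → ∀ w ∈ B k, S.c (j k) w ≠ S.c (j k) y := by
          intro k hB w hw hc
          obtain ⟨x, hx, hxz⟩ := h k (j k)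
          exact hx.2 hB w hw (by rw [hc, hy, hxz _ le_rfl])
        have hmem : y ∈ range e := by
          by_contra hne
          have hU : (range e)ᶜ ∈ S.nhd y := by
            rw [← hS.nhds_eq]
            exact he.isClosed_range.isOpen_compl.mem_nhds hne
          obtain ⟨n, ε, hε, hn⟩ := S.exists_of_mem_nhd hU
          obtain ⟨q, hq1, hq2⟩ := exists_rat_btwn (lt_add_of_pos_right (S.η y) hε)
          obtain ⟨k, hk⟩ := hE (n, S.c n y, q)
          refine hmiss k (fun x hx => ?_) y ⟨by rw [hk], by rw [hk]; exact hq1.le⟩ rfl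
          simp only [B, hk] at hx
          exact hn (e x) hx.1 (hx.2.trans_lt hq2) ⟨x, rfl⟩
        obtain ⟨x, rfl⟩ := hmem
        exact ⟨x, hy, fun k => ⟨hyK k, hmiss k⟩⟩ }
  exact ⟨T, hS.comp he.isInducing⟩

end Strat

section Rational

/-- The cells of a rational sequence. -/
def seqCell (i : ℕ) (x : ℕ → ℚ) : ℤ := ratCell i.unpair.2 (x i.unpair.1)

theorem eventually_seqCell (i : ℕ) (x : ℕ → ℚ) : ∀ᶠ y in 𝓝 x, seqCell i y = seqCell i x :=
  ((continuous_apply i.unpair.1).continuousAt (x := x)).eventually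
    (eventually_ratCell i.unpair.2 (x i.unpair.1))

theorem exists_seqCell_subset {x : ℕ → ℚ} {U : Set (ℕ → ℚ)} (hU : U ∈ 𝓝 x) :
    ∃ n, ∀ y, (∀ i < n, seqCell i y = seqCell i x) → y ∈ U := by
  obtain ⟨n, -, hn⟩ := isCode_ratCell.pi.exists_cone hU 0
  refine ⟨Nat.pair n n, fun y hy => hn y ?_⟩
  funext k
  by_cases hk : k < n
  · simp only [hk, if_true, Option.some.injEq]
    funext i
    by_cases hi : i < n
    · have := hy (Nat.pair k i) ((Nat.pair_lt_pair_left i hk).trans (Nat.pair_lt_pair_right n hi))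
      simpa [seqCell, hi] using this
    · simp [hi]
  · simp [hk]

/-- The code of the first cells of a rational sequence. -/
def seqCode (n : ℕ) (x : ℕ → ℚ) : ℕ :=
  Encodable.encode ((List.range n).map fun i => seqCell i x)

theorem seqCode_eq_iff {n : ℕ} {x y : ℕ → ℚ} :
    seqCode n x = seqCode n y ↔ ∀ i < n, seqCell i x = seqCell i y := by
  rw [seqCode, seqCode, Encodable.encode_inj, List.map_inj_left]
  simp

theorem exists_seqCode_sum (x : ℕ → ℚ) (N : ℕ) {ε : ℝ} (hε : 0 < ε) :
    ∃ n, ∀ y, seqCode n y = seqCode n x →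
      ∑ k ∈ Finset.range N, (x k : ℝ) ^ 2 - ε < ∑ k ∈ Finset.range N, (y k : ℝ) ^ 2 := by
  have hc : Continuous fun y : ℕ → ℚ => ∑ k ∈ Finset.range N, (y k : ℝ) ^ 2 :=
    continuous_finsetSum _ fun k _ => (Rat.continuous_coe_real.comp (continuous_apply k)).pow 2
  obtain ⟨n, hn⟩ := exists_seqCell_subset
    (hc.continuousAt.preimage_mem_nhds (lt_mem_nhds (sub_lt_self _ hε)))
  exact ⟨n, fun y hy => hn y (seqCode_eq_iff.1 hy)⟩

theorem RatSq.sum_le_sq (x : RatSq) (N : ℕ) : ∑ k ∈ Finset.range N, (x.1 k : ℝ) ^ 2 ≤ x.sq :=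
  x.2.sum_le_tsum _ fun _ _ => sq_nonneg _

/-- The stratification of the rational points of Hilbert space. -/
def RatSq.strat : Strat (Gr RatSq.sq) where
  c n x := seqCode n x.pt.1
  η x := x.pt.sq
  K k j := {x | Encodable.encode (x.pt.1 k) ≤ j ∧ x.pt.sq ≤ j}
  refine_succ n x y h := by
    rw [seqCode_eq_iff] at h ⊢
    exact fun i hi => h i (hi.trans n.lt_succ_self)
  c_zero x y := seqCode_eq_iff.2 fun i hi => (Nat.not_lt_zero i hi).elim
  sep x y h := by
    refine Gr.ext (Subtype.ext ?_)
    by_contra hne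
    obtain ⟨n, hn⟩ := exists_seqCell_subset
      (isOpen_ne.mem_nhds (Ne.symm hne) : {z | z ≠ x.pt.1} ∈ 𝓝 y.pt.1)
    exact hn x.pt.1 (seqCode_eq_iff.1 (h n)) rfl
  nonneg x := tsum_nonneg fun _ => sq_nonneg _
  lsc x ε hε := by
    obtain ⟨N, hN⟩ := (x.pt.2.hasSum.tendsto_sum_nat.eventually
      (lt_mem_nhds (sub_lt_self x.pt.sq (half_pos hε)))).exists
    obtain ⟨n, hn⟩ := exists_seqCode_sum x.pt.1 N (half_pos hε)
    refine ⟨n, fun y hy => ?_⟩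
    have h1 := hn _ hy
    have h2 := y.pt.sum_le_sq N
    linarith
  K_mono k i j hij x hx := ⟨hx.1.trans hij, hx.2.trans (by exact_mod_cast hij)⟩
  K_cover k x := by
    obtain ⟨j, hj⟩ := exists_nat_ge x.pt.sq
    exact ⟨max (Encodable.encode (x.pt.1 k)) j, le_max_left _ _, hj.trans (by
      exact_mod_cast le_max_right _ _)⟩
  complete j z h := by
    have hq : ∀ k, ∃ q : ℚ, Encodable.encode q ≤ j k ∧
        ∀ m, ∃ y : Gr RatSq.sq, y.pt.1 k = q ∧ ∀ l ≤ m, seqCode l y.pt.1 = z l := by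
      intro k
      by_contra hcon
      push Not at hcon
      choose! m hm using hcon
      have hfin : {q : ℚ | Encodable.encode q ≤ j k}.Finite :=
        (finite_Iic (j k)).preimage Encodable.encode_injective.injOn
      obtain ⟨M, hM⟩ := (hfin.image m).bddAbove
      obtain ⟨y, hy, hyz⟩ := h k M
      obtain ⟨l, hl, hne⟩ := hm _ hy.1 y rfl
      exact hne (hyz l (hl.trans (hM ⟨_, hy.1, rfl⟩)))
    choose x hx hxz using hq
    have hcode : ∀ m, seqCode m x = z m := by
      intro m
      obtain ⟨y, -, hy⟩ := h 0 m
      rw [← hy m le_rfl, seqCode_eq_iff]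
      intro i hi
      obtain ⟨y', hy', hyz'⟩ := hxz i.unpair.1 m
      have := seqCode_eq_iff.1 ((hyz' m le_rfl).trans (hy m le_rfl).symm) i hi
      rw [← this, seqCell, seqCell, hy']
    have hsum : ∀ k N, ∑ i ∈ Finset.range N, (x i : ℝ) ^ 2 ≤ j k := by
      intro k N
      refine le_of_forall_pos_le_add fun ε hε => ?_
      obtain ⟨n, hn⟩ := exists_seqCode_sum x N hε
      obtain ⟨y, hy, hyz⟩ := h k n
      have h1 := hn y.pt.1 (by rw [hyz n le_rfl, hcode])
      have h2 := y.pt.sum_le_sq N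
      linarith [hy.2]
    have hs : Summable fun n => (x n : ℝ) ^ 2 :=
      summable_of_sum_range_le (fun _ => sq_nonneg _) (hsum 0)
    exact ⟨⟨⟨x, hs⟩⟩, hcode, fun k => ⟨hx k,
      Real.tsum_le_of_sum_range_le (fun _ => sq_nonneg _) (hsum k)⟩⟩

theorem RatSq.induces_strat : RatSq.strat.Induces := by
  have hval : Continuous fun x : Gr RatSq.sq => x.pt.1 :=
    continuous_subtype_val.comp Gr.continuous_pt
  refine Strat.induces_of _ (fun n x => ?_) Gr.continuous_val fun x => ?_
  · have h : ∀ᶠ y : Gr RatSq.sq in 𝓝 x, ∀ i ∈ Iio n, seqCell i y.pt.1 = seqCell i x.pt.1 := by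
      rw [eventually_all_finite (finite_Iio n)]
      exact fun i _ => hval.continuousAt.eventually (eventually_seqCell i _)
    exact h.mono fun y hy => seqCode_eq_iff.2 hy
  · rw [(Gr.isInducing RatSq.sq).nhds_eq_comap, ← map_le_iff_le_comap]
    have h1 : Tendsto (fun y : Gr RatSq.sq => y.pt) (RatSq.strat.nhd x) (𝓝 x.pt) := by
      have hi : IsInducing (Subtype.val : RatSq → ℕ → ℚ) := IsInducing.subtypeVal
      refine hi.tendsto_nhds_iff.2 ?_
      intro U hU
      obtain ⟨n, hn⟩ := exists_seqCell_subset hU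
      exact (RatSq.strat.eventually_nhd_c n x).mono fun y hy => hn _ (seqCode_eq_iff.1 hy)
    have h2 : Tendsto (fun y : Gr RatSq.sq => y.pt.sq) (RatSq.strat.nhd x) (𝓝 x.pt.sq) :=
      (continuous_snd.tendsto _).comp tendsto_comap
    exact h1.prodMk_nhds h2

end Rational

theorem Strat.exists_of_factor {X Z : Type*} [TopologicalSpace X] [TopologicalSpace Z]
    [Nonempty Z] (h : X × Z ≃ₜ ErdosSpace) : ∃ T : Strat X, T.Induces := by
  have hT2 : T2Space ErdosSpace := inferInstanceAs
    (T2Space {x : lp (fun _ : ℕ => ℝ) 2 // ∀ n : ℕ, ∃ q : ℚ, x.val n = (q : ℝ)})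
  have : T2Space (X × Z) := h.symm.t2Space
  let z : Z := Classical.arbitrary Z
  have hz : IsClosedEmbedding fun x : X => (x, z) :=
    Function.LeftInverse.isClosedEmbedding (f := Prod.fst) (fun _ => rfl) continuous_fst
      (by fun_prop)
  exact RatSq.strat.exists_of_isClosedEmbedding RatSq.induces_strat
    ((h.trans ErdosSpace.homeoRat).isClosedEmbedding.comp hz)

namespace Strat

variable {X : Type*} (S : Strat X)

/-- The maximal height of a point of `F` in the piece numbered `i`, or zero. -/
def peak (i : ℕ) (F : Set X) : ℝ := sSup (S.η '' {x ∈ F | S.c i.unpair.1 x = i.unpair.2})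

theorem peak_nonneg (i : ℕ) (F : Set X) : 0 ≤ S.peak i F :=
  Real.sSup_nonneg (by rintro _ ⟨x, -, rfl⟩; exact S.nonneg x)

theorem le_peak {F : Set X} (hF : F.Finite) {x : X} (hx : x ∈ F) (l : ℕ) :
    S.η x ≤ S.peak (Nat.pair l (S.c l x)) F :=
  le_csSup ((hF.subset (sep_subset _ _)).image _).bddAbove ⟨x, ⟨hx, by simp⟩, rfl⟩

theorem peak_le {i : ℕ} {F : Set X} {b : ℝ} (hb : 0 ≤ b)
    (h : ∀ x ∈ F, S.c i.unpair.1 x = i.unpair.2 → S.η x ≤ b) : S.peak i F ≤ b :=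
  Real.sSup_le (by rintro _ ⟨x, hx, rfl⟩; exact h x hx.1 hx.2) hb

theorem peak_eq_or (i : ℕ) {F : Set X} (hF : F.Finite) :
    S.peak i F = 0 ∨ ∃ x ∈ F, S.c i.unpair.1 x = i.unpair.2 ∧ S.η x = S.peak i F := by
  rcases eq_empty_or_nonempty {x ∈ F | S.c i.unpair.1 x = i.unpair.2} with h | h
  · left
    rw [peak, h, image_empty, Real.sSup_empty]
  · right
    obtain ⟨x, hx, hxe⟩ := (h.image S.η).csSup_mem ((hF.subset (sep_subset _ _)).image _)
    exact ⟨x, hx.1, hx.2, hxe⟩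

theorem exists_peak_le {F : Set X} (hF : F.Finite) : ∃ b, 0 ≤ b ∧ ∀ x ∈ F, S.η x ≤ b := by
  obtain ⟨b, hb⟩ := (hF.image S.η).bddAbove
  exact ⟨max 0 b, le_max_left _ _, fun x hx => (hb ⟨x, hx, rfl⟩).trans (le_max_right _ _)⟩

/-- A weighted sum of the peaks. -/
def peakSum (w : ℕ → ℝ) (F : Set X) : ℝ := ∑' i, w i * S.peak i F

theorem summable_peak {w : ℕ → ℝ} (hw : ∀ i, 0 ≤ w i ∧ w i ≤ (1 / 2) ^ i) {F : Set X}
    (hF : F.Finite) : Summable fun i => w i * S.peak i F := by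
  obtain ⟨b, hb0, hb⟩ := S.exists_peak_le hF
  refine Summable.of_nonneg_of_le (fun i => mul_nonneg (hw i).1 (S.peak_nonneg i F)) (fun i => ?_)
    (summable_geometric_two.mul_right b)
  exact mul_le_mul (hw i).2 (S.peak_le hb0 fun x hx _ => hb x hx) (S.peak_nonneg i F)
    (by positivity)

theorem image_c_mono {m l : ℕ} (hml : m ≤ l) {F G : Set X} (h : S.c l '' F ⊆ S.c l '' G) :
    S.c m '' F ⊆ S.c m '' G := by
  rintro _ ⟨x, hx, rfl⟩
  obtain ⟨y, hy, hyx⟩ := h ⟨x, hx, rfl⟩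
  exact ⟨y, hy, S.c_mono hml hyx⟩

theorem exists_peak_lsc (i : ℕ) {F : Set X} (hF : F.Finite) {ε : ℝ} (hε : 0 < ε) :
    ∃ m, ∀ G : Set X, G.Finite → S.c m '' F ⊆ S.c m '' G → S.peak i F - ε < S.peak i G := by
  rcases S.peak_eq_or i hF with h | ⟨x, hx, hxi, hxe⟩
  · refine ⟨0, fun G _ _ => ?_⟩
    have := S.peak_nonneg i G
    linarith
  · obtain ⟨m, hm⟩ := S.lsc x ε hε
    refine ⟨max m i.unpair.1, fun G hG hFG => ?_⟩
    obtain ⟨y, hy, hyx⟩ := hFG ⟨x, hx, rfl⟩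
    have h1 := hm y (S.c_mono (le_max_left _ _) hyx)
    have h2 := S.le_peak hG hy i.unpair.1
    rw [S.c_mono (le_max_right _ _) hyx, hxi, Nat.pair_unpair] at h2
    linarith

theorem exists_peakSum_lsc {w : ℕ → ℝ} (hw : ∀ i, 0 ≤ w i ∧ w i ≤ (1 / 2) ^ i) {F : Set X}
    (hF : F.Finite) {ε : ℝ} (hε : 0 < ε) :
    ∃ m, ∀ G : Set X, G.Finite → S.c m '' F ⊆ S.c m '' G →
      S.peakSum w F - ε < S.peakSum w G := by
  obtain ⟨N, hN⟩ := ((S.summable_peak hw hF).hasSum.tendsto_sum_nat.eventually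
    (lt_mem_nhds (sub_lt_self (S.peakSum w F) (half_pos hε)))).exists
  choose m hm using fun i => S.exists_peak_lsc i hF (by positivity : 0 < ε / 4)
  refine ⟨(Finset.range N).sup m, fun G hG hFG => ?_⟩
  have h1 : ∑ i ∈ Finset.range N, w i * S.peak i G ≤ S.peakSum w G :=
    (S.summable_peak hw hG).sum_le_tsum _ fun i _ => mul_nonneg (hw i).1 (S.peak_nonneg i G)
  have h2 : ∑ i ∈ Finset.range N, w i * S.peak i F ≤
      ∑ i ∈ Finset.range N, (w i * S.peak i G + (1 / 2) ^ i * (ε / 4)) := by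
    refine Finset.sum_le_sum fun i hi => ?_
    have h := (hm i G hG (S.image_c_mono (Finset.le_sup hi) hFG)).le
    have h3 := mul_le_mul_of_nonneg_left (sub_le_iff_le_add.1 h) (hw i).1
    have h4 := mul_le_mul_of_nonneg_right (hw i).2 (by positivity : 0 ≤ ε / 4)
    linarith
  have h3 : ∑ i ∈ Finset.range N, (1 / 2 : ℝ) ^ i ≤ 2 :=
    (summable_geometric_two.sum_le_tsum _ fun i _ => by positivity).trans tsum_geometric_two.le
  rw [Finset.sum_add_distrib, ← Finset.sum_mul] at h2
  have h4 := mul_le_mul_of_nonneg_right h3 (by positivity : 0 ≤ ε / 4)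
  linarith

end Strat

theorem exists_fin_range_eq {X : Type*} {n : ℕ} {F : Set X} (hne : F.Nonempty) (hfin : F.Finite)
    (hcard : F.ncard ≤ n) : ∃ g : Fin n → X, range g = F := by
  have := hfin.to_subtype
  have := hne.to_subtype
  have : Fintype F := Fintype.ofFinite F
  obtain ⟨e⟩ : Nonempty (F ↪ Fin n) := by
    rw [Function.Embedding.nonempty_iff_card_le, Fintype.card_fin, ← Nat.card_eq_fintype_card]
    exact hcard
  refine ⟨fun i => (Function.invFun e i : F), ?_⟩
  ext x
  constructor
  · rintro ⟨i, rfl⟩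
    exact (Function.invFun e i).2
  · intro hx
    exact ⟨e ⟨x, hx⟩, congrArg Subtype.val (Function.leftInverse_invFun e.injective ⟨x, hx⟩)⟩

namespace HypFn

variable {X : Type*} [TopologicalSpace X] {n : ℕ} (S : Strat X)

theorem finite (F : HypFn n X) : F.1.Finite := F.2.2.1

/-- The code of the pieces met by a finite set. -/
def code (l : ℕ) (F : HypFn n X) : ℕ := Encodable.encode (F.finite.image (S.c l)).toFinset

theorem code_eq_iff {l : ℕ} {F G : HypFn n X} :
    code S l F = code S l G ↔ S.c l '' F.1 = S.c l '' G.1 := by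
  rw [code, code, Encodable.encode_inj, Finite.toFinset_inj]

theorem code_mono {m l : ℕ} (hml : m ≤ l) {F G : HypFn n X} (h : code S l F = code S l G) :
    code S m F = code S m G := by
  rw [code_eq_iff] at h ⊢
  exact (S.image_c_mono hml h.subset).antisymm (S.image_c_mono hml h.symm.subset)

theorem subset_of_forall_code {F G : HypFn n X} (h : ∀ l, code S l F = code S l G) :
    F.1 ⊆ G.1 := by
  intro x hx
  by_contra hxG
  have hsep : ∀ y ∈ G.1, ∃ l, S.c l y ≠ S.c l x := by
    intro y hy
    by_contra hcon
    push Not at hcon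
    exact hxG (S.sep y x hcon ▸ hy)
  choose! l hl using hsep
  obtain ⟨M, hM⟩ := (G.finite.image l).bddAbove
  obtain ⟨y, hy, hyx⟩ := ((code_eq_iff S).1 (h M)).subset ⟨x, hx, rfl⟩
  exact hl y hy (S.c_mono (hM ⟨y, hy, rfl⟩) hyx)

theorem exists_complete (j z : ℕ → ℕ)
    (h : ∀ k m, ∃ F : HypFn n X, F.1 ⊆ S.K k (j k) ∧ ∀ l ≤ m, code S l F = z l) :
    ∃ F : HypFn n X, (∀ l, code S l F = z l) ∧ ∀ k, F.1 ⊆ S.K k (j k) := by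
  choose F hFK hFz using h
  choose g hg using fun m => exists_fin_range_eq (F 0 m).2.1 (F 0 m).2.2.1 (F 0 m).2.2.2
  let u : Ultrafilter ℕ := hyperfilter ℕ
  have hge : ∀ l, ∀ᶠ m in u, l ≤ m := fun l =>
    (eventually_ge_atTop l).filter_mono Nat.hyperfilter_le_atTop
  have hlim : ∀ i l, ∃ d, ∀ᶠ m in u, S.c l (g m i) = d := by
    intro i l
    have hmem : ∀ᶠ m in u, ∃ d ∈ S.c l '' (F 0 l).1, S.c l (g m i) = d := by
      filter_upwards [hge l] with m hm
      refine ⟨_, ?_, rfl⟩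
      rw [← (code_eq_iff S).1 ((hFz 0 m l hm).trans (hFz 0 l l le_rfl).symm), ← hg m]
      exact ⟨g m i, ⟨i, rfl⟩, rfl⟩
    obtain ⟨d, -, hd⟩ :=
      (Ultrafilter.eventually_exists_mem_iff ((F 0 l).finite.image (S.c l))).1 hmem
    exact ⟨d, hd⟩
  choose t ht using hlim
  have hx : ∀ i, ∃ x, (∀ l, S.c l x = t i l) ∧ ∀ k, x ∈ S.K k (j k) := by
    intro i
    refine S.complete j (t i) fun k m => ?_
    have hev : ∀ᶠ M in u, ∀ l ∈ Iic m, S.c l (g M i) = t i l := by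
      rw [eventually_all_finite (finite_Iic m)]
      exact fun l _ => ht i l
    obtain ⟨M, hM, hmM⟩ := (hev.and (hge m)).exists
    have hmem : S.c M (g M i) ∈ S.c M '' (F k M).1 := by
      rw [(code_eq_iff S).1 ((hFz k M M le_rfl).trans (hFz 0 M M le_rfl).symm), ← hg M]
      exact ⟨g M i, ⟨i, rfl⟩, rfl⟩
    obtain ⟨y, hy, hye⟩ := hmem
    exact ⟨y, hFK k M hy, fun l hl => by rw [S.c_mono (hl.trans hmM) hye, hM l hl]⟩
  choose x hxt hxK using hx
  have hne : Nonempty (Fin n) := by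
    obtain ⟨y, hy⟩ := (F 0 0).2.1
    rw [← hg 0] at hy
    exact ⟨hy.choose⟩
  have hcard : (range x).ncard ≤ n := by
    rw [← image_univ]
    exact (ncard_image_le finite_univ).trans (by simp)
  let G : HypFn n X := ⟨range x, range_nonempty x, finite_range x, hcard⟩
  refine ⟨G, fun l => ?_, fun k => ?_⟩
  · have hev : ∀ᶠ m in u, ∀ i, S.c l (g m i) = t i l := by
      rw [eventually_all]
      exact fun i => ht i l
    obtain ⟨m, hm, hlm⟩ := (hev.and (hge l)).exists
    rw [← hFz 0 m l hlm, code_eq_iff, ← hg m]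
    change S.c l '' range x = S.c l '' range (g m)
    rw [← range_comp, ← range_comp]
    congr 1
    funext i
    simp only [Function.comp_apply, hxt, hm]
  · rintro _ ⟨i, rfl⟩
    exact hxK i k

/-- The stratification of the symmetric product. -/
def strat : Strat (HypFn n X) where
  c := code S
  η F := S.peakSum (fun i => (1 / 2) ^ i) F.1
  K k j := {F | F.1 ⊆ S.K k j}
  refine_succ l F G h := code_mono S l.le_succ h
  c_zero F G := by
    rw [code_eq_iff]
    obtain ⟨x, hx⟩ := F.2.1
    obtain ⟨y, hy⟩ := G.2.1
    ext d
    constructor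
    · rintro ⟨x', -, rfl⟩
      exact ⟨y, hy, S.c_zero _ _⟩
    · rintro ⟨y', -, rfl⟩
      exact ⟨x, hx, S.c_zero _ _⟩
  sep F G h := Subtype.ext ((subset_of_forall_code S h).antisymm
    (subset_of_forall_code S fun l => (h l).symm))
  nonneg F := tsum_nonneg fun i => mul_nonneg (by positivity) (S.peak_nonneg i F.1)
  lsc F ε hε := by
    obtain ⟨m, hm⟩ := S.exists_peakSum_lsc (w := fun i => (1 / 2) ^ i)
      (fun i => ⟨by positivity, le_rfl⟩) F.finite hε
    exact ⟨m, fun G hG => hm G.1 G.finite ((code_eq_iff S).1 hG).symm.subset⟩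
  K_mono k i j hij F hF := hF.trans (S.K_mono k hij)
  K_cover k F := by
    choose j hj using S.K_cover k
    obtain ⟨M, hM⟩ := (F.finite.image j).bddAbove
    exact ⟨M, fun x hx => S.K_mono k (hM ⟨x, hx, rfl⟩) (hj x)⟩
  complete := exists_complete S

theorem eventually_subset {F : HypFn n X} {U : Set X} (hU : IsOpen U) (h : F.1 ⊆ U) :
    ∀ᶠ G : HypFn n X in 𝓝 F, G.1 ⊆ U := by
  have ho : IsOpen {G : HypFn n X | G.1 ⊆ U} := ⟨{G : Set X | G ⊆ U},
    TopologicalSpace.isOpen_generateFrom_of_mem (Or.inl ⟨U, hU, F.2.1.mono h, rfl⟩), rfl⟩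
  exact ho.mem_nhds h

theorem eventually_inter_nonempty {F : HypFn n X} {U : Set X} (hU : IsOpen U)
    (h : (F.1 ∩ U).Nonempty) : ∀ᶠ G : HypFn n X in 𝓝 F, (G.1 ∩ U).Nonempty := by
  have ho : IsOpen {G : HypFn n X | (G.1 ∩ U).Nonempty} := ⟨{G : Set X | (G ∩ U).Nonempty},
    TopologicalSpace.isOpen_generateFrom_of_mem
      (Or.inr ⟨U, hU, h.mono inter_subset_right, rfl⟩), rfl⟩
  exact ho.mem_nhds h

variable {S}

theorem isOpen_piece (hS : S.Induces) (l : ℕ) (D : Set ℕ) : IsOpen {x | S.c l x ∈ D} := by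
  rw [isOpen_iff_mem_nhds]
  intro x hx
  rw [hS.nhds_eq]
  exact (S.eventually_nhd_c l x).mono fun y hy => (show S.c l y ∈ D from hy ▸ hx)

theorem eventually_code (hS : S.Induces) (l : ℕ) (F : HypFn n X) :
    ∀ᶠ G in 𝓝 F, code S l G = code S l F := by
  have h1 := eventually_subset (isOpen_piece hS l (S.c l '' F.1)) fun x hx => ⟨x, hx, rfl⟩
  have h2 : ∀ᶠ G : HypFn n X in 𝓝 F, ∀ x ∈ F.1,
      (G.1 ∩ {y | S.c l y ∈ ({S.c l x} : Set ℕ)}).Nonempty := by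
    rw [eventually_all_finite F.finite]
    exact fun x hx => eventually_inter_nonempty (isOpen_piece hS l _) ⟨x, hx, rfl⟩
  filter_upwards [h1, h2] with G h1 h2
  rw [code_eq_iff]
  apply Subset.antisymm
  · rintro _ ⟨x, hx, rfl⟩
    exact h1 hx
  · rintro _ ⟨x, hx, rfl⟩
    obtain ⟨y, hy, hyx⟩ := h2 x hx
    exact ⟨y, hy, hyx⟩

theorem continuous_η (hS : S.Induces) : Continuous S.η := continuous_snd.comp hS.continuous

theorem continuous_peak (hS : S.Induces) (i : ℕ) :
    Continuous fun F : HypFn n X => S.peak i F.1 := by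
  rw [continuous_iff_continuousAt]
  intro F
  rw [ContinuousAt, tendsto_order]
  constructor
  · intro a ha
    obtain ⟨m, hm⟩ := S.exists_peak_lsc i F.finite (sub_pos.2 ha)
    filter_upwards [eventually_code hS m F] with G hG
    have := hm G.1 G.finite ((code_eq_iff S).1 hG).symm.subset
    linarith
  · intro a ha
    obtain ⟨b, hb, hba⟩ := exists_between ha
    have ho : IsOpen ({x | S.c i.unpair.1 x ∈ {i.unpair.2}ᶜ} ∪ {x | S.η x < b}) :=
      (isOpen_piece hS _ _).union (isOpen_lt (continuous_η hS) continuous_const)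
    filter_upwards [eventually_subset ho (F := F) fun x hx => by
      by_cases h : S.c i.unpair.1 x = i.unpair.2
      · right
        have := S.le_peak F.finite hx i.unpair.1
        rw [h, Nat.pair_unpair] at this
        exact this.trans_lt hb
      · exact Or.inl h] with G hG
    refine (S.peak_le ((S.peak_nonneg i F.1).trans hb.le) fun x hx hxi => ?_).trans_lt hba
    rcases hG hx with h | h
    · exact (h hxi).elim
    · exact le_of_lt h

theorem continuous_strat_η (hS : S.Induces) : Continuous (strat (n := n) S).η := by
  rw [continuous_iff_continuousAt]
  intro F
  obtain ⟨b, hb0, hb⟩ := S.exists_peak_le F.finite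
  have hev : ∀ᶠ G : HypFn n X in 𝓝 F, G.1 ⊆ {x | S.η x < b + 1} :=
    eventually_subset (isOpen_lt (continuous_η hS) continuous_const) fun x hx => by
      have := hb x hx
      rw [mem_ofPred_eq]
      linarith
  refine tendsto_tsum_of_dominated_convergence (bound := fun i => (1 / 2) ^ i * (b + 1))
    (summable_geometric_two.mul_right _)
    (fun i => ((continuous_peak hS i).continuousAt (x := F)).const_mul _) ?_
  filter_upwards [hev] with G hG i
  have h0 := S.peak_nonneg i G.1
  rw [Real.norm_eq_abs, abs_of_nonneg (by positivity)]
  gcongr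
  exact S.peak_le (by positivity) fun x hx _ => (hG hx).le

theorem eventually_peak_lt (i : ℕ) (F : HypFn n X) {ε : ℝ} (hε : 0 < ε) :
    ∀ᶠ G in (strat S).nhd F, S.peak i G.1 < S.peak i F.1 + ε := by
  let w : ℕ → ℝ := fun k => if k = i then 0 else (1 / 2) ^ k
  have hw : ∀ k, 0 ≤ w k ∧ w k ≤ (1 / 2) ^ k := fun k => by
    by_cases hk : k = i
    · simp [w, hk]
    · simp [w, hk]
  have hsplit : ∀ G : HypFn n X,
      (strat S).η G = (1 / 2) ^ i * S.peak i G.1 + S.peakSum w G.1 := fun G => by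
    have h1 := S.summable_peak (w := fun i => (1 / 2) ^ i)
      (fun i => ⟨by positivity, le_rfl⟩) G.finite
    refine (h1.tsum_eq_add_tsum_ite i).trans ?_
    congr 1
    refine tsum_congr fun k => ?_
    by_cases hk : k = i
    · simp [w, hk]
    · simp [w, hk]
  have hδ : 0 < (1 / 2 : ℝ) ^ i * ε / 2 := by positivity
  obtain ⟨m, hm⟩ := S.exists_peakSum_lsc hw F.finite hδ
  filter_upwards [(strat S).eventually_nhd_c m F, (strat S).eventually_nhd_η hδ] with G h1 h2
  have h3 := hm G.1 G.finite ((code_eq_iff S).1 h1).symm.subset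
  rw [hsplit, hsplit] at h2
  have h4 : (1 / 2 : ℝ) ^ i * S.peak i G.1 < (1 / 2) ^ i * (S.peak i F.1 + ε) := by linarith
  exact lt_of_mul_lt_mul_left h4 (by positivity)

theorem exists_separating_level (S : Strat X) (F : HypFn n X) :
    ∃ L, ∀ l ≥ L, InjOn (S.c l) F.1 := by
  have hsep : ∀ p : X × X, ∃ l, p.1 ≠ p.2 → S.c l p.1 ≠ S.c l p.2 := by
    intro p
    by_contra hcon
    push Not at hcon
    exact (hcon 0).1 (S.sep _ _ fun l => (hcon l).2)
  choose l hl using hsep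
  obtain ⟨M, hM⟩ := ((F.finite.prod F.finite).image l).bddAbove
  refine ⟨M, fun m hm x hx y hy hxy => ?_⟩
  by_contra hne
  exact hl (x, y) hne (S.c_mono ((hM ⟨(x, y), ⟨hx, hy⟩, rfl⟩).trans hm) hxy)

theorem eventually_lt_of_injOn {F : HypFn n X} {l : ℕ} (hl : InjOn (S.c l) F.1) {x : X}
    (hx : x ∈ F.1) {ε : ℝ} (hε : 0 < ε) :
    ∀ᶠ G in (strat S).nhd F, ∀ y ∈ G.1, S.c l y = S.c l x → S.η y < S.η x + ε := by
  filter_upwards [eventually_peak_lt (Nat.pair l (S.c l x)) F hε] with G hG y hy hyx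
  have h1 := S.le_peak G.finite hy l
  rw [hyx] at h1
  have h2 : S.peak (Nat.pair l (S.c l x)) F.1 ≤ S.η x := by
    refine S.peak_le (S.nonneg x) fun x' hx' hc => ?_
    rw [Nat.unpair_pair] at hc
    rw [hl hx' hx hc]
  linarith

theorem induces_strat (hS : S.Induces) : (strat (n := n) S).Induces := by
  refine Strat.induces_of _ (eventually_code hS) (continuous_strat_η hS) fun F => ?_
  obtain ⟨L, hL⟩ := exists_separating_level S F
  have hnhds : ∀ U : Set X, IsOpen U → ∀ x ∈ U, ∃ l, ∃ ε > 0,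
      ∀ y, S.c l y = S.c l x → S.η y < S.η x + ε → y ∈ U := fun U hU x hx =>
    S.exists_of_mem_nhd (by rw [← hS.nhds_eq]; exact hU.mem_nhds hx)
  refine (map_le_iff_le_comap.1 ?_).trans
    (@nhds_induced _ _ (VietorisTop inferInstance) Subtype.val F).ge
  refine TopologicalSpace.tendsto_nhds_generateFrom_iff.2 ?_
  rintro _ (⟨U, hU, -, rfl⟩ | ⟨U, hU, -, rfl⟩) hFU
  · choose! l ε hε hy using fun x (hx : x ∈ F.1) => hnhds U hU x (hFU hx)
    obtain ⟨M, hM⟩ := (F.finite.image l).bddAbove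
    have hev : ∀ᶠ G in (strat S).nhd F, ∀ x ∈ F.1, ∀ y ∈ G.1,
        S.c (max L M) y = S.c (max L M) x → S.η y < S.η x + ε x := by
      rw [eventually_all_finite F.finite]
      exact fun x hx => eventually_lt_of_injOn (hL _ (le_max_left _ _)) hx (hε x hx)
    filter_upwards [hev, (strat S).eventually_nhd_c (max L M) F] with G h1 h2 y hyG
    obtain ⟨x, hx, hxy⟩ := ((code_eq_iff S).1 h2).subset ⟨y, hyG, rfl⟩
    exact hy x hx y (S.c_mono ((hM ⟨x, hx, rfl⟩).trans (le_max_right _ _)) hxy.symm)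
      (h1 x hx y hyG hxy.symm)
  · obtain ⟨x, hx, hxU⟩ := hFU
    obtain ⟨l, ε, hε, hy⟩ := hnhds U hU x hxU
    filter_upwards [eventually_lt_of_injOn (hL (max L l) (le_max_left _ _)) hx hε,
      (strat S).eventually_nhd_c (max L l) F] with G h1 h2
    obtain ⟨y, hyG, hyx⟩ := ((code_eq_iff S).1 h2).symm.subset ⟨x, hx, rfl⟩
    exact ⟨y, hyG, hy y (S.c_mono (le_max_right _ _) hyx) (h1 y hyG hyx)⟩

end HypFn

/-- If `X` is a separable metrizable `𝔈`-factor, then so is `F_n(X)` for every `n ≥ 1`. -/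
theorem hypFn_erdos_factor {X : Type*} [TopologicalSpace X]
    [TopologicalSpace.MetrizableSpace X] [TopologicalSpace.SeparableSpace X]
    (n : ℕ) (hn : 1 ≤ n)
    (h : ∃ (Z : Type) (_ : TopologicalSpace Z), Nonempty ((X × Z) ≃ₜ ErdosSpace)) :
    ∃ (Z : Type) (_ : TopologicalSpace Z),
      Nonempty ((HypFn n X × Z) ≃ₜ ErdosSpace) := by
  obtain ⟨Z, _, ⟨e⟩⟩ := h
  have hne : Nonempty ErdosSpace := ⟨⟨0, fun _ => ⟨0, by simp⟩⟩⟩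
  obtain ⟨x, z⟩ := e.symm hne.some
  have : Nonempty Z := ⟨z⟩
  have : Nonempty (HypFn n X) :=
    ⟨⟨{x}, singleton_nonempty x, finite_singleton x, by rwa [ncard_singleton]⟩⟩
  obtain ⟨S, hS⟩ := Strat.exists_of_factor e
  exact ⟨ErdosSpace, inferInstance, (HypFn.strat S).prod_erdosSpace (HypFn.induces_strat hS)⟩
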